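/- arXiv:2401.01757 — 4 statements merged into one kernel-verified Lean document; each statement's English description precedes it below -/
import Mathlib

section
/- Maximal integrability for martingales with linear structure: let (M_n)_{n≥0} be a nonnegative martingale with M_0 = 1 satisfying the linear-structure convexity property. If P(M_∞ > 0) > 0, then E[M_∞*] < ∞, i.e. the running supremum sup_{n≥0} M_n is integrable. -/
open MeasureTheory ProbabilityTheory Filter Topology
open scoped ENNReal NNReal

noncomputable section

variable {Ω : Type*} {mΩ : MeasurableSpace Ω}

/-- A nonnegative martingale `M` has the *linear-structure convexity property* if for every
`k, ℓ ∈ ℕ` and every convex `f : [0,∞) → ℝ` for which the relevant expectations are defined,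
almost surely on the event `{M_k > 0}` one has `E[f(M_{k+ℓ}/M_k) | F_k] ≤ E[f(M_ℓ)]`. -/
def LinearStructure (P : Measure Ω) (ℱ : Filtration ℕ mΩ) (M : ℕ → Ω → ℝ) : Prop :=
  ∀ (k l : ℕ) (f : ℝ → ℝ), ConvexOn ℝ (Set.Ici 0) f →
    Integrable (fun a => f (M (k + l) a / M k a)) P →
    Integrable (fun a => f (M l a)) P →
    ∀ᵐ a ∂P, 0 < M k a →
      (P[(fun a => f (M (k + l) a / M k a))|ℱ k]) a ≤ ∫ a, f (M l a) ∂P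

theorem LSaux_integrable {P : Measure Ω} [IsProbabilityMeasure P] {g : Ω → ℝ}
    (hg : AEMeasurable g P) (h0 : 0 ≤ᵐ[P] g) : Integrable (fun a => min (g a) 1) P := by
  refine Integrable.of_bound (C := 1) (hg.min aemeasurable_const).aestronglyMeasurable ?_
  filter_upwards [h0] with a ha
  have ha' : 0 ≤ g a := ha
  rw [Real.norm_eq_abs, abs_of_nonneg (le_min ha' zero_le_one)]
  exact min_le_right _ _

theorem LSaux_convex : ConvexOn ℝ (Set.Ici 0) (fun x : ℝ => -min x 1) := by
  have h : ConcaveOn ℝ (Set.Ici (0:ℝ)) (fun x : ℝ => min x 1) :=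
    (concaveOn_id (convex_Ici 0)).inf (concaveOn_const 1 (convex_Ici 0))
  exact h.neg

/-- The key estimate on an `ℱ k`-measurable set where `M k` exceeds `t`. -/
theorem LSaux_set (P : Measure Ω) [IsProbabilityMeasure P] (ℱ : Filtration ℕ mΩ) (M : ℕ → Ω → ℝ)
    (hmart : Martingale M ℱ P) (hpos : ∀ n, 0 ≤ᵐ[P] M n)
    (hlin : LinearStructure P ℱ M) (c : ℝ) (hc : 0 < c) (k l : ℕ)
    (hl : 2 * c ≤ ∫ a, min (M l a) 1 ∂P) (t : ℝ) (ht : 0 < t)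
    (A : Set Ω) (hA : MeasurableSet[ℱ k] A) (hAt : ∀ a ∈ A, t < M k a) :
    ENNReal.ofReal c * P A ≤ P (A ∩ {a | t < M (k + l) a / c}) := by
  have hmeas : ∀ n, Measurable (M n) := fun n =>
    ((hmart.stronglyMeasurable n).mono (ℱ.le n)).measurable
  have hA' : MeasurableSet A := ℱ.le k A hA
  have hq0 : 0 ≤ᵐ[P] fun a => M (k + l) a / M k a := by
    filter_upwards [hpos k, hpos (k + l)] with a h1 h2
    exact div_nonneg h2 h1
  have hqi : Integrable (fun a => min (M (k + l) a / M k a) 1) P :=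
    LSaux_integrable ((hmeas (k + l)).div (hmeas k)).aemeasurable hq0
  have hli := LSaux_integrable (hmeas l).aemeasurable (hpos l)
  have hB : MeasurableSet {a | t < M (k + l) a / c} :=
    measurableSet_lt measurable_const ((hmeas _).div_const c)
  have key := hlin k l (fun x => -min x 1) LSaux_convex hqi.neg hli.neg
  have h1 : ∫ a in A, -min (M (k + l) a / M k a) 1 ∂P ≤ ∫ a in A, -(2 * c) ∂P := by
    have hneg : Integrable (fun a => -min (M (k + l) a / M k a) 1) P := hqi.neg
    rw [← setIntegral_condExp (ℱ.le k) hneg hA]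
    refine setIntegral_mono_on_ae integrable_condExp.integrableOn
      (integrable_const _).integrableOn hA' ?_
    filter_upwards [key] with a ha haA
    refine (ha (ht.trans (hAt a haA))).trans ?_
    rw [integral_neg]
    linarith
  have h2 : ∫ a in A, min (M (k + l) a / M k a) 1 ∂P ≤
      ∫ a in A, (c + Set.indicator {a | t < M (k + l) a / c} (fun _ => (1:ℝ)) a) ∂P := by
    refine setIntegral_mono_on hqi.integrableOn
      ((integrable_const _).add ((integrable_const _).indicator hB)).integrableOn hA' ?_
    intro a ha
    have hk := hAt a ha
    by_cases hb : t < M (k + l) a / c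
    · rw [Set.indicator_of_mem (by exact hb)]
      exact (min_le_right _ _).trans (by linarith)
    · rw [Set.indicator_of_notMem (by exact hb)]
      refine (min_le_left _ _).trans ?_
      rw [add_zero, div_le_iff₀ (ht.trans hk)]
      rw [not_lt, div_le_iff₀ hc] at hb
      nlinarith
  rw [integral_neg, setIntegral_const] at h1
  have hind : Integrable (Set.indicator {a | t < M (k + l) a / c} (fun _ => (1:ℝ)))
      (P.restrict A) := (integrable_const _).indicator hB
  rw [integral_add (integrable_const _) hind, setIntegral_const,
    setIntegral_indicator hB, setIntegral_const] at h2
  simp only [smul_eq_mul] at h1 h2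
  have h3 : c * P.real A ≤ P.real (A ∩ {a | t < M (k + l) a / c}) := by linarith
  rw [← ofReal_measureReal (μ := P) (s := A),
    ← ofReal_measureReal (μ := P) (s := A ∩ {a | t < M (k + l) a / c}),
    ← ENNReal.ofReal_mul hc.le]
  exact ENNReal.ofReal_le_ofReal h3

/-- The running maximum. -/
def LSaux_R (M : ℕ → Ω → ℝ) (N : ℕ) (a : Ω) : ℝ :=
  (Finset.range (N + 1)).sup' Finset.nonempty_range_add_one (fun k => M k a)

theorem LSaux_tail (P : Measure Ω) [IsProbabilityMeasure P] (ℱ : Filtration ℕ mΩ) (M : ℕ → Ω → ℝ)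
    (hmart : Martingale M ℱ P) (hpos : ∀ n, 0 ≤ᵐ[P] M n)
    (hlin : LinearStructure P ℱ M) (c : ℝ) (hc : 0 < c) (L : ℕ)
    (hL : ∀ l, L ≤ l → 2 * c ≤ ∫ a, min (M l a) 1 ∂P) (N : ℕ) (t : ℝ) (ht : 0 < t) :
    ENNReal.ofReal c * P {a | t < LSaux_R M N a} ≤ P {a | t < M (N + L) a / c} := by
  have hmeas : ∀ n, Measurable (M n) := fun n =>
    ((hmart.stronglyMeasurable n).mono (ℱ.le n)).measurable
  let A : ℕ → Set Ω := fun k => {a | t < M k a} ∩ ⋂ j ∈ Finset.range k, {a | t < M j a}ᶜ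
  have hA : ∀ k, MeasurableSet[ℱ k] (A k) := by
    intro k
    have h : ∀ j, j ≤ k → MeasurableSet[ℱ k] {a | t < M j a} := by
      intro j hj
      have hm : Measurable[ℱ k] (M j) :=
        ((hmart.stronglyMeasurable j).mono (ℱ.mono hj)).measurable
      exact hm measurableSet_Ioi
    refine MeasurableSet.inter (h k le_rfl) ?_
    refine Finset.measurableSet_biInter _ fun j hj => (h j ?_).compl
    exact (Finset.mem_range.1 hj).le
  have hA' : ∀ k, MeasurableSet (A k) := fun k => ℱ.le k _ (hA k)
  have hB : MeasurableSet {a | t < M (N + L) a / c} :=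
    measurableSet_lt measurable_const ((hmeas _).div_const c)
  have hlt : ∀ i j, i < j → Disjoint (A i) (A j) := by
    intro i j hij
    rw [Set.disjoint_left]
    intro a hi hj
    have := hj.2
    simp only [Set.mem_iInter] at this
    exact this i (Finset.mem_range.2 hij) hi.1
  have hdis : ∀ i j, i ≠ j → Disjoint (A i) (A j) := by
    intro i j hij
    rcases lt_or_gt_of_ne hij with h | h
    · exact hlt i j h
    · exact (hlt j i h).symm
  have hsub : {a | t < LSaux_R M N a} ⊆ ⋃ k ∈ Finset.range (N + 1), A k := by
    intro a ha
    have ha' : t < LSaux_R M N a := ha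
    rw [LSaux_R, Finset.lt_sup'_iff] at ha'
    classical
    obtain ⟨k, hk, hka⟩ := ha'
    have hex : ∃ k, t < M k a := ⟨k, hka⟩
    simp only [Set.mem_iUnion]
    refine ⟨Nat.find hex, ?_, Nat.find_spec hex, ?_⟩
    · have := Nat.find_min' hex hka
      rw [Finset.mem_range] at hk ⊢
      omega
    · simp only [Set.mem_iInter]
      intro j hj
      exact Nat.find_min hex (Finset.mem_range.1 hj)
  calc ENNReal.ofReal c * P {a | t < LSaux_R M N a}
      ≤ ENNReal.ofReal c * ∑ k ∈ Finset.range (N + 1), P (A k) := by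
        gcongr
        exact (measure_mono hsub).trans (measure_biUnion_finset_le _ _)
    _ = ∑ k ∈ Finset.range (N + 1), ENNReal.ofReal c * P (A k) := Finset.mul_sum _ _ _
    _ ≤ ∑ k ∈ Finset.range (N + 1), P (A k ∩ {a | t < M (N + L) a / c}) := by
        refine Finset.sum_le_sum fun k hk => ?_
        have hk' : k ≤ N := Nat.lt_succ_iff.1 (Finset.mem_range.1 hk)
        have := LSaux_set P ℱ M hmart hpos hlin c hc k (N + L - k) (hL _ (by omega)) t ht
          (A k) (hA k) (fun a ha => ha.1)
        rwa [show k + (N + L - k) = N + L by omega] at this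
    _ = P (⋃ k ∈ Finset.range (N + 1), A k ∩ {a | t < M (N + L) a / c}) := by
        refine (measure_biUnion_finset ?_ fun k _ => (hA' k).inter hB).symm
        intro i _ j _ hij
        exact (hdis i j hij).mono Set.inter_subset_left Set.inter_subset_left
    _ ≤ P {a | t < M (N + L) a / c} := by
        refine measure_mono ?_
        simp only [Set.iUnion_subset_iff]
        intro k _
        exact Set.inter_subset_right

/-- Maximal integrability for martingales with linear structure: if
`(M_n)_{n≥0}` is a nonnegative martingale with `M_0 = 1` satisfying the linear-structure
convexity property, and `P(M_∞ > 0) > 0`, then `E[M_∞*] < ∞`, i.e. the running supremum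
`sup_n M_n` is integrable (here computed in `[0,∞]`). -/
theorem maximal_integrability_linear_structure
    (P : Measure Ω) [IsProbabilityMeasure P] (ℱ : Filtration ℕ mΩ) (M : ℕ → Ω → ℝ)
    (hmart : Martingale M ℱ P) (hpos : ∀ n, 0 ≤ᵐ[P] M n)
    (hM0 : ∀ᵐ a ∂P, M 0 a = 1)
    (hlin : LinearStructure P ℱ M)
    (Minf : Ω → ℝ)
    (htend : ∀ᵐ a ∂P, Tendsto (fun n => M n a) atTop (𝓝 (Minf a)))
    (hposlim : 0 < P {a | 0 < Minf a}) :
    ∫⁻ a, ⨆ n : ℕ, ENNReal.ofReal (M n a) ∂P < ⊤ := by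
  have hmeas : ∀ n, Measurable (M n) := fun n =>
    ((hmart.stronglyMeasurable n).mono (ℱ.le n)).measurable
  have hposall : ∀ᵐ a ∂P, ∀ n, 0 ≤ M n a := ae_all_iff.2 hpos
  have hMinf_meas : AEMeasurable Minf P :=
    aemeasurable_of_tendsto_metrizable_ae' (fun n => (hmeas n).aemeasurable) htend
  have hMinf0 : 0 ≤ᵐ[P] Minf := by
    filter_upwards [hposall, htend] with a h1 h2
    exact ge_of_tendsto' h2 h1
  have hinfi := LSaux_integrable hMinf_meas hMinf0
  have heta : 0 < ∫ a, min (Minf a) 1 ∂P := by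
    rw [integral_pos_iff_support_of_nonneg_ae _ hinfi]
    · refine hposlim.trans_le (measure_mono ?_)
      intro a ha
      exact (lt_min (show 0 < Minf a from ha) zero_lt_one).ne'
    · filter_upwards [hMinf0] with a ha
      exact le_min ha zero_le_one
  have hlim : Tendsto (fun n => ∫ a, min (M n a) 1 ∂P) atTop (𝓝 (∫ a, min (Minf a) 1 ∂P)) := by
    refine tendsto_integral_of_dominated_convergence (fun _ => (1:ℝ))
      (fun n => (LSaux_integrable (hmeas n).aemeasurable (hpos n)).aestronglyMeasurable)
      (integrable_const _) ?_ ?_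
    · intro n
      filter_upwards [hpos n] with a ha
      have ha' : 0 ≤ M n a := ha
      rw [Real.norm_eq_abs, abs_of_nonneg (le_min ha' zero_le_one)]
      exact min_le_right _ _
    · filter_upwards [htend] with a ha
      exact ha.min tendsto_const_nhds
  obtain ⟨c, hc, L, hL⟩ : ∃ c : ℝ, 0 < c ∧ ∃ L : ℕ, ∀ l, L ≤ l →
      2 * c ≤ ∫ a, min (M l a) 1 ∂P := by
    refine ⟨(∫ a, min (Minf a) 1 ∂P) / 4, by linarith, ?_⟩
    have := hlim.eventually_const_le
      (show 2 * ((∫ a, min (Minf a) 1 ∂P) / 4) < ∫ a, min (Minf a) 1 ∂P by linarith)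
    exact eventually_atTop.1 this
  have hRmeas : ∀ N, Measurable (LSaux_R M N) := by
    intro N
    exact Finset.measurable_range_sup'' (fun k _ => hmeas k)
  have hc0 : ENNReal.ofReal c ≠ 0 := by simpa using hc
  have hbound : ∀ N, ∫⁻ a, ENNReal.ofReal (LSaux_R M N a) ∂P ≤
      (ENNReal.ofReal c)⁻¹ * ENNReal.ofReal (1 / c) := by
    intro N
    have hR0 : 0 ≤ᵐ[P] LSaux_R M N := by
      filter_upwards [hpos 0] with a ha
      exact le_trans ha (Finset.le_sup' (fun k => M k a) (Finset.mem_range.2 (Nat.succ_pos N)))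
    have hM0' : 0 ≤ᵐ[P] fun a => M (N + L) a / c := by
      filter_upwards [hpos (N + L)] with a ha
      exact div_nonneg ha hc.le
    have hmi := (hmart.integrable (N + L)).div_const c
    have hint : ∫ a, M (N + L) a ∂P = 1 := by
      have := hmart.setIntegral_eq (Nat.zero_le (N + L)) (s := Set.univ) MeasurableSet.univ
      rw [setIntegral_univ, setIntegral_univ] at this
      rw [← this, integral_congr_ae hM0]
      simp
    calc ∫⁻ a, ENNReal.ofReal (LSaux_R M N a) ∂P
        = ∫⁻ t in Set.Ioi 0, P {a | t < LSaux_R M N a} :=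
          lintegral_eq_lintegral_meas_lt P hR0 (hRmeas N).aemeasurable
      _ ≤ ∫⁻ t in Set.Ioi 0, (ENNReal.ofReal c)⁻¹ * P {a | t < M (N + L) a / c} := by
          refine setLIntegral_mono' measurableSet_Ioi fun t ht => ?_
          rw [mul_comm, ← div_eq_mul_inv,
            ENNReal.le_div_iff_mul_le (Or.inl hc0) (Or.inl ENNReal.ofReal_ne_top), mul_comm]
          exact LSaux_tail P ℱ M hmart hpos hlin c hc L hL N t ht
      _ = (ENNReal.ofReal c)⁻¹ * ∫⁻ t in Set.Ioi 0, P {a | t < M (N + L) a / c} :=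
          lintegral_const_mul' _ _ (ENNReal.inv_ne_top.2 hc0)
      _ = (ENNReal.ofReal c)⁻¹ * ∫⁻ a, ENNReal.ofReal (M (N + L) a / c) ∂P := by
          rw [lintegral_eq_lintegral_meas_lt P hM0' ((hmeas _).div_const c).aemeasurable]
      _ = (ENNReal.ofReal c)⁻¹ * ENNReal.ofReal (1 / c) := by
          rw [← ofReal_integral_eq_lintegral_ofReal hmi hM0', integral_div, hint]
  have hsup : ∀ a, ⨆ n : ℕ, ENNReal.ofReal (M n a) = ⨆ N : ℕ, ENNReal.ofReal (LSaux_R M N a) := by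
    intro a
    refine le_antisymm (iSup_mono fun n => ENNReal.ofReal_le_ofReal ?_) (iSup_le fun N => ?_)
    · exact Finset.le_sup' (fun k => M k a) (Finset.mem_range.2 (Nat.lt_succ_self n))
    · obtain ⟨k, _, hk⟩ := Finset.exists_mem_eq_sup' (Finset.nonempty_range_add_one (n := N))
        (fun k => M k a)
      rw [LSaux_R, hk]
      exact le_iSup (fun n => ENNReal.ofReal (M n a)) k
  simp_rw [hsup]
  rw [lintegral_iSup (fun N => (hRmeas N).ennreal_ofReal)]
  · refine (iSup_le hbound).trans_lt ?_
    exact ENNReal.mul_lt_top (ENNReal.inv_lt_top.2 (pos_iff_ne_zero.2 hc0)) ENNReal.ofReal_lt_top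
  · intro N N' h a
    refine ENNReal.ofReal_le_ofReal (Finset.sup'_mono _ ?_ _)
    intro x hx
    rw [Finset.mem_range] at hx ⊢
    omega

end
end

section
/- L^p bound for martingales with linear structure: let (M_n)_{n≥0} be a nonnegative martingale with M_0 = 1 satisfying the linear-structure convexity property, and suppose there exists K > 1 such that P(M_{n+1} ≤ K·M_n) = 1 for every n ∈ ℕ. If P(M_∞ > 0) > 0, then there exists p > 1 such that sup_{n≥0} E[M_n^p] < ∞. Moreover, the set of exponents p > 1 with sup_{n≥0} E[M_n^p] < ∞ is open: if sup_n E[M_n^p] < ∞ for some p > 1 then there exists q > p with sup_n E[M_n^q] < ∞. -/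
open MeasureTheory ProbabilityTheory Filter Topology
open scoped ENNReal NNReal

noncomputable section

variable {Ω : Type*} {mΩ : MeasurableSpace Ω}

lemma aux_set_bound (P : Measure Ω) [IsProbabilityMeasure P] (ℱ : Filtration ℕ mΩ) (M : ℕ → Ω → ℝ)
    (hlin : LinearStructure P ℱ M) (k l : ℕ) (f : ℝ → ℝ) (hf : ConvexOn ℝ (Set.Ici 0) f)
    (h1 : Integrable (fun a => f (M (k + l) a / M k a)) P)
    (h2 : Integrable (fun a => f (M l a)) P) (A : Set Ω) (hA : MeasurableSet[ℱ k] A)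
    (hApos : ∀ a ∈ A, 0 < M k a) :
    ∫ a in A, f (M (k + l) a / M k a) ∂P ≤ (∫ a, f (M l a) ∂P) * P.real A := by
  rw [← setIntegral_condExp (ℱ.le k) h1 hA]
  calc _ ≤ ∫ a in A, (∫ a, f (M l a) ∂P) ∂P := by
        apply setIntegral_mono_on_ae integrable_condExp.integrableOn
          (integrable_const _).integrableOn (ℱ.le k _ hA)
        filter_upwards [hlin k l f hf h1 h2] with a ha haA using ha (hApos a haA)
    _ = _ := by simp [mul_comm]

lemma aux_c (P : Measure Ω) [IsProbabilityMeasure P] (ℱ : Filtration ℕ mΩ) (M : ℕ → Ω → ℝ)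
    (hmart : Martingale M ℱ P) (hpos : ∀ n, 0 ≤ᵐ[P] M n)
    (Minf : Ω → ℝ)
    (htend : ∀ᵐ a ∂P, Tendsto (fun n => M n a) atTop (𝓝 (Minf a)))
    (hposlim : 0 < P {a | 0 < Minf a}) :
    ∃ c : ℝ, 0 ≤ c ∧ c < 1 ∧ ∀ l, ∫ a, max (1 - M l a) 0 ∂P ≤ c := by
  have hmeas : ∀ n, Measurable (M n) := fun n =>
    ((hmart.stronglyMeasurable n).mono (ℱ.le n)).measurable
  have hMinf : AEMeasurable Minf P :=
    aemeasurable_of_tendsto_metrizable_ae atTop (fun n => (hmeas n).aemeasurable) htend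
  have hsub := ((martingale_const ℱ P (1 : ℝ)).sub hmart).submartingale.pos
  have hmono : Monotone (fun l => ∫ a, max (1 - M l a) 0 ∂P) := by
    intro i j hij
    have := hsub.setIntegral_le hij MeasurableSet.univ
    simp only [setIntegral_univ] at this
    exact this
  have hlim : Tendsto (fun l => ∫ a, max (1 - M l a) 0 ∂P) atTop
      (𝓝 (∫ a, max (1 - Minf a) 0 ∂P)) := by
    apply tendsto_integral_of_dominated_convergence (fun _ => (1 : ℝ))
    · intro n
      exact ((measurable_const.sub (hmeas n)).max measurable_const).aestronglyMeasurable
    · exact integrable_const _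
    · intro n
      filter_upwards [hpos n] with a ha
      have ha' : 0 ≤ M n a := ha
      rw [Real.norm_of_nonneg (le_max_right _ _)]
      exact max_le (by linarith) zero_le_one
    · filter_upwards [htend] with a ha
      exact (tendsto_const_nhds.sub ha).max tendsto_const_nhds
  have hInfnn : ∀ᵐ a ∂P, 0 ≤ Minf a := by
    filter_upwards [htend, ae_all_iff.2 hpos] with a ha hb
    exact ge_of_tendsto' ha hb
  have hint : Integrable (fun a => max (1 - Minf a) 0) P := by
    refine Integrable.of_bound (f := fun a => max (1 - Minf a) 0)
      ((aemeasurable_const.sub hMinf).max aemeasurable_const).aestronglyMeasurable 1 ?_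
    filter_upwards [hInfnn] with a ha
    rw [Real.norm_of_nonneg (le_max_right _ _)]
    exact max_le (by linarith) zero_le_one
  refine ⟨∫ a, max (1 - Minf a) 0 ∂P, integral_nonneg fun a => le_max_right _ _, ?_,
    fun l => hmono.ge_of_tendsto hlim l⟩
  by_contra hcon
  push Not at hcon
  have hz : ∫ a, (1 - max (1 - Minf a) 0) ∂P = 0 := by
    apply le_antisymm
    · rw [integral_sub (integrable_const _) hint]
      simp; linarith
    · apply integral_nonneg_of_ae
      filter_upwards [hInfnn] with a ha
      simp only [Pi.zero_apply, sub_nonneg]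
      exact max_le (by linarith) zero_le_one
  rw [integral_eq_zero_iff_of_nonneg_ae] at hz
  · apply hposlim.ne'
    have : ∀ᵐ a ∂P, ¬ 0 < Minf a := by
      filter_upwards [hz] with a ha h
      simp only [Pi.zero_apply] at ha
      have : max (1 - Minf a) 0 < 1 := max_lt (by linarith) zero_lt_one
      linarith
    simpa [ae_iff] using this
  · filter_upwards [hInfnn] with a ha
    simp only [Pi.zero_apply, sub_nonneg]
    exact max_le (by linarith) zero_le_one
  · exact (integrable_const _).sub hint

lemma aux_ratio (P : Measure Ω) (M : ℕ → Ω → ℝ)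
    (K : ℝ) (hK : 1 < K) (hstep : ∀ n : ℕ, ∀ᵐ a ∂P, M (n + 1) a ≤ K * M n a) (k l : ℕ) :
    ∀ᵐ a ∂P, M (k + l) a ≤ K ^ l * M k a := by
  induction l with
  | zero => simp
  | succ l ih =>
    filter_upwards [ih, hstep (k + l)] with a h1 h2
    calc M (k + (l + 1)) a ≤ K * M (k + l) a := h2
      _ ≤ K * (K ^ l * M k a) := by gcongr
      _ = _ := by ring

lemma aux_tail (P : Measure Ω) [IsProbabilityMeasure P] (ℱ : Filtration ℕ mΩ) (M : ℕ → Ω → ℝ)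
    (hmart : Martingale M ℱ P) (hpos : ∀ n, 0 ≤ᵐ[P] M n)
    (hM0 : ∀ᵐ a ∂P, M 0 a = 1)
    (hlin : LinearStructure P ℱ M)
    (K : ℝ) (hK : 1 < K)
    (hstep : ∀ n : ℕ, ∀ᵐ a ∂P, M (n + 1) a ≤ K * M n a)
    (c : ℝ) (hc0 : 0 ≤ c) (hc1 : c < 1) (hc : ∀ l, ∫ a, max (1 - M l a) 0 ∂P ≤ c)
    (p : ℝ) (hp : 1 ≤ p) (C : ℝ) (hC : ∀ n, ∫ a, M n a ^ p ∂P ≤ C) (hC0 : 0 ≤ C)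
    (t : ℝ) (ht : 1 ≤ t) (N : ℕ) :
    ∫ a in {a | t < M N a}, M N a ^ p ∂P ≤
      (K * t) ^ p * C * ((1 - c) / 2)⁻¹ * P.real {a | (1 - c) / 2 * t < M N a} := by
  have hmeas : ∀ n, Measurable (M n) := fun n =>
    ((hmart.stronglyMeasurable n).mono (ℱ.le n)).measurable
  have hmeas' : ∀ j k, j ≤ k → Measurable[ℱ k] (M j) := fun j k hjk =>
    ((hmart.stronglyMeasurable j).mono (ℱ.mono hjk)).measurable
  set ε := (1 - c) / 2 with hε
  have hε0 : 0 < ε := by rw [hε]; linarith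
  have hratio : ∀ k l, ∀ᵐ a ∂P, 0 ≤ M (k + l) a / M k a ∧ M (k + l) a / M k a ≤ K ^ l := by
    intro k l
    filter_upwards [aux_ratio P M K hK hstep k l, hpos k, hpos (k + l)] with a h1 h2 h3
    refine ⟨div_nonneg h3 h2, div_le_of_le_mul₀ h2 (by positivity) h1⟩
  have hbd : ∀ l, ∀ᵐ a ∂P, 0 ≤ M l a ∧ M l a ≤ K ^ l := by
    intro l
    filter_upwards [aux_ratio P M K hK hstep 0 l, hM0, hpos l] with a h1 h2 h3
    rw [zero_add, h2, mul_one] at h1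
    exact ⟨h3, h1⟩
  have hintp : ∀ (X : Ω → ℝ) (B : ℝ), Measurable X → (∀ᵐ a ∂P, 0 ≤ X a ∧ X a ≤ B) →
      Integrable (fun a => X a ^ p) P := by
    intro X B hX hb
    apply Integrable.of_bound (hX.pow_const p).aestronglyMeasurable (B ^ p)
    filter_upwards [hb] with a ha
    rw [Real.norm_of_nonneg (Real.rpow_nonneg ha.1 _)]
    exact Real.rpow_le_rpow ha.1 ha.2 (by linarith)
  have hintm : ∀ (X : Ω → ℝ) (B : ℝ), Measurable X → (∀ᵐ a ∂P, 0 ≤ X a ∧ X a ≤ B) →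
      Integrable (fun a => max (1 - X a) 0) P := by
    intro X B hX hb
    refine Integrable.of_bound (f := fun a => max (1 - X a) 0)
      ((measurable_const.sub hX).max measurable_const).aestronglyMeasurable 1 ?_
    filter_upwards [hb] with a ha
    rw [Real.norm_of_nonneg (le_max_right _ _)]
    exact max_le (by linarith) zero_le_one
  have hconv : ConvexOn ℝ (Set.Ici 0) (fun x : ℝ => max (1 - x) 0) := by
    apply ConvexOn.sup
    · exact (convexOn_const 1 (convex_Ici 0)).sub (concaveOn_id (convex_Ici 0))
    · exact convexOn_const 0 (convex_Ici 0)
  let A : ℕ → Set Ω := fun k => {a | t < M k a} ∩ ⋂ j ∈ Finset.range k, {a | M j a ≤ t}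
  have hA : ∀ k, MeasurableSet[ℱ k] (A k) := by
    intro k
    refine MeasurableSet.inter (measurableSet_lt measurable_const (hmeas' k k le_rfl)) ?_
    refine Finset.measurableSet_biInter _ fun j hj => ?_
    exact measurableSet_le (hmeas' j k (Finset.mem_range.1 hj).le) measurable_const
  have hA' : ∀ k, MeasurableSet (A k) := fun k => ℱ.le k _ (hA k)
  have hApos : ∀ k, ∀ a ∈ A k, 0 < M k a := fun k a ha =>
    lt_trans (by linarith) (show t < M k a from ha.1)
  have hAle : ∀ k, ∀ᵐ a ∂P, a ∈ A k → M k a ≤ K * t := by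
    intro k
    cases k with
    | zero =>
      filter_upwards [hM0] with a ha _
      rw [ha]; nlinarith
    | succ k =>
      filter_upwards [hstep k] with a ha h
      have : M k a ≤ t := by
        have := h.2
        simp only [Set.mem_iInter] at this
        exact this k (by simp)
      nlinarith
  have hdisj : ∀ i j, i < j → Disjoint (A i) (A j) := by
    intro i j hij
    rw [Set.disjoint_left]
    intro a hi hj
    have h1 : t < M i a := hi.1
    have := hj.2
    simp only [Set.mem_iInter] at this
    have h2 : M i a ≤ t := this i (by simpa using hij)
    linarith
  have hpair : Set.Pairwise (↑(Finset.range (N + 1))) (Function.onFun Disjoint A) := by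
    intro i _ j _ hij
    rcases lt_or_gt_of_ne hij with h | h
    · exact hdisj i j h
    · exact (hdisj j i h).symm
  have hcover : {a | t < M N a} ⊆ ⋃ k ∈ Finset.range (N + 1), A k := by
    intro a ha
    classical
    have hex : ∃ k, t < M k a := ⟨N, ha⟩
    simp only [Set.mem_iUnion]
    refine ⟨Nat.find hex, ?_, Nat.find_spec hex, ?_⟩
    · simp only [Finset.mem_range]
      exact Nat.lt_succ_of_le (Nat.find_min' hex ha)
    · simp only [Set.mem_iInter]
      intro j hj
      exact not_lt.1 (Nat.find_min hex (Finset.mem_range.1 hj))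
  have hNint := hintp (M N) _ (hmeas N) (hbd N)
  -- the key estimate on each `A k`
  have hkey : ∀ k ∈ Finset.range (N + 1), ∫ a in A k, M N a ^ p ∂P ≤
      (K * t) ^ p * C * ε⁻¹ * P.real (A k ∩ {a | ε * t < M N a}) := by
    intro k hk
    obtain ⟨l, rfl⟩ := Nat.exists_eq_add_of_le (Nat.lt_succ_iff.1 (Finset.mem_range.1 hk))
    have hXm : Measurable (fun a => M (k + l) a / M k a) := (hmeas _).div (hmeas _)
    have e1 : ∫ a in A k, M (k + l) a ^ p ∂P ≤ (K * t) ^ p * (C * P.real (A k)) := by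
      calc ∫ a in A k, M (k + l) a ^ p ∂P
          ≤ ∫ a in A k, (K * t) ^ p * (M (k + l) a / M k a) ^ p ∂P := by
            apply setIntegral_mono_on_ae hNint.integrableOn
              ((hintp _ _ hXm (hratio k l)).const_mul _).integrableOn (hA' k)
            filter_upwards [hAle k, hratio k l, hpos (k + l)] with a h1 h2 h3 ha
            have h0 := hApos k a ha
            rw [← Real.mul_rpow (by positivity) h2.1]
            apply Real.rpow_le_rpow h3 _ (by linarith)
            calc M (k + l) a = M k a * (M (k + l) a / M k a) := by field_simp
              _ ≤ _ := mul_le_mul_of_nonneg_right (h1 ha) h2.1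
        _ = (K * t) ^ p * ∫ a in A k, (M (k + l) a / M k a) ^ p ∂P := integral_const_mul _ _
        _ ≤ (K * t) ^ p * (C * P.real (A k)) := by
            apply mul_le_mul_of_nonneg_left _ (by positivity)
            refine (aux_set_bound P ℱ M hlin k l (fun x => x ^ p) (convexOn_rpow hp)
              (hintp _ _ hXm (hratio k l)) (hintp _ _ (hmeas l) (hbd l)) (A k) (hA k)
              (hApos k)).trans ?_
            exact mul_le_mul_of_nonneg_right (hC l) measureReal_nonneg
    have e2 : ε * P.real (A k) ≤ P.real (A k ∩ {a | ε * t < M (k + l) a}) := by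
      have h1 := (aux_set_bound P ℱ M hlin k l (fun x => max (1 - x) 0) hconv
              (hintm _ _ hXm (hratio k l)) (hintm _ _ (hmeas l) (hbd l)) (A k) (hA k)
              (hApos k)).trans (mul_le_mul_of_nonneg_right (hc l) measureReal_nonneg)
      have hS : MeasurableSet {a | ε * t < M (k + l) a} :=
        measurableSet_lt measurable_const (hmeas _)
      have hI : Integrable (Set.indicator {a | ε * t < M (k + l) a} (fun _ => (1 : ℝ))) P :=
        (integrable_const (1 : ℝ)).indicator hS
      have hI1 : Integrable (fun _ : Ω => 1 - ε) P := integrable_const _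
      have h2 : ∫ a in A k, ((1 - ε) - Set.indicator {a | ε * t < M (k + l) a} (fun _ => (1 : ℝ)) a) ∂P
          ≤ ∫ a in A k, max (1 - M (k + l) a / M k a) 0 ∂P := by
        apply setIntegral_mono_on
          (hI1.sub hI).integrableOn
          (hintm _ _ hXm (hratio k l)).integrableOn (hA' k)
        intro a ha
        rw [Pi.sub_apply]
        have h0 := hApos k a ha
        have h0' : t < M k a := ha.1
        by_cases hh : ε * t < M (k + l) a
        · rw [Set.indicator_of_mem (by exact hh)]
          exact le_max_of_le_right (by linarith)
        · rw [Set.indicator_of_notMem (by exact hh)]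
          apply le_max_of_le_left
          have : M (k + l) a / M k a ≤ ε := by
            rw [div_le_iff₀ h0]
            push Not at hh
            nlinarith
          linarith
      rw [integral_sub hI1.integrableOn hI.integrableOn,
        setIntegral_indicator hS] at h2
      simp only [setIntegral_const, smul_eq_mul, mul_one] at h2
      have : (1 - ε) - c = ε := by rw [hε]; ring
      have h3 := h2.trans h1
      calc ε * P.real (A k) = (1 - ε - c) * P.real (A k) := by rw [this]
        _ = P.real (A k) * (1 - ε) - c * P.real (A k) := by ring
        _ ≤ _ := by linarith
    calc _ ≤ (K * t) ^ p * (C * P.real (A k)) := e1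
      _ = (K * t) ^ p * C * ε⁻¹ * (ε * P.real (A k)) := by field_simp
      _ ≤ _ := mul_le_mul_of_nonneg_left e2 (by positivity)
  calc ∫ a in {a | t < M N a}, M N a ^ p ∂P
      ≤ ∫ a in ⋃ k ∈ Finset.range (N + 1), A k, M N a ^ p ∂P := by
        apply setIntegral_mono_set hNint.integrableOn
        · apply ae_restrict_of_ae
          filter_upwards [hpos N] with a ha using Real.rpow_nonneg ha _
        · exact hcover.eventuallyLE
    _ = ∑ k ∈ Finset.range (N + 1), ∫ a in A k, M N a ^ p ∂P :=
        integral_biUnion_finset _ (fun k _ => hA' k) hpair (fun k _ => hNint.integrableOn)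
    _ ≤ ∑ k ∈ Finset.range (N + 1),
          (K * t) ^ p * C * ε⁻¹ * P.real (A k ∩ {a | ε * t < M N a}) := Finset.sum_le_sum hkey
    _ = (K * t) ^ p * C * ε⁻¹ *
          P.real (⋃ k ∈ Finset.range (N + 1), (A k ∩ {a | ε * t < M N a})) := by
        rw [← Finset.mul_sum, measureReal_biUnion_finset]
        · intro i hi j hj hij
          exact (hpair hi hj hij).mono Set.inter_subset_left Set.inter_subset_left
        · intro k _
          exact (hA' k).inter (measurableSet_lt measurable_const (hmeas _))
    _ ≤ _ := by
        apply mul_le_mul_of_nonneg_left _ (by positivity)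
        exact measureReal_mono (Set.iUnion₂_subset fun k _ => Set.inter_subset_right)


lemma aux_step (P : Measure Ω) [IsProbabilityMeasure P] (Y : Ω → ℝ) (hY : Measurable Y)
    (B C D ε p η : ℝ) (hY0 : ∀ᵐ a ∂P, 0 ≤ Y a ∧ Y a ≤ B) (hε : 0 < ε)
    (hp : 1 ≤ p) (hη : 0 < η) (hD : 0 ≤ D) (hC0 : 0 ≤ C)
    (hC : ∫ a, Y a ^ p ∂P ≤ C)
    (htail : ∀ t, 1 ≤ t → ∫ a in {a | t < Y a}, Y a ^ p ∂P ≤ D * t ^ p * P.real {a | ε * t < Y a})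
    (hsmall : η * D * (ε⁻¹) ^ (p + η) ≤ 1 / 2) :
    ∫⁻ a, ENNReal.ofReal (Y a ^ (p + η)) ∂P ≤ ENNReal.ofReal (2 * C) := by
  have hnn : 0 ≤ᵐ[P] Y := by filter_upwards [hY0] with a ha using ha.1
  have hYp : Measurable (fun a => ENNReal.ofReal (Y a ^ p)) := (hY.pow_const p).ennreal_ofReal
  have hYη : Measurable (fun a => ENNReal.ofReal (Y a ^ η)) := (hY.pow_const η).ennreal_ofReal
  have hint : Integrable (fun a => Y a ^ p) P := by
    apply Integrable.of_bound (hY.pow_const p).aestronglyMeasurable (B ^ p)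
    filter_upwards [hY0] with a ha
    rw [Real.norm_of_nonneg (Real.rpow_nonneg ha.1 _)]
    exact Real.rpow_le_rpow ha.1 ha.2 (by linarith)
  have hnnp : 0 ≤ᵐ[P] fun a => Y a ^ p := by
    filter_upwards [hnn] with a ha using Real.rpow_nonneg ha _
  set μ := P.withDensity (fun a => ENNReal.ofReal (Y a ^ p)) with hμ
  have hset : ∀ t, μ {a | t < Y a} = ENNReal.ofReal (∫ a in {a | t < Y a}, Y a ^ p ∂P) := by
    intro t
    rw [hμ, withDensity_apply _ (measurableSet_lt measurable_const hY),
      ofReal_integral_eq_lintegral_ofReal hint.integrableOn (ae_restrict_of_ae hnnp)]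
  set I := ∫⁻ a, ENNReal.ofReal (Y a ^ (p + η)) ∂P with hI
  have hIfin : I ≠ ⊤ := by
    apply ne_of_lt
    calc I ≤ ∫⁻ a, ENNReal.ofReal (B ^ (p + η)) ∂P := by
          apply lintegral_mono_ae
          filter_upwards [hY0] with a ha
          exact ENNReal.ofReal_le_ofReal (Real.rpow_le_rpow ha.1 ha.2 (by linarith))
      _ < ⊤ := by simp
  have hI1 : I = ENNReal.ofReal η *
      ∫⁻ t in Set.Ioi 0, μ {a : Ω | t < Y a} * ENNReal.ofReal (t ^ (η - 1)) := by
    rw [← lintegral_rpow_eq_lintegral_meas_lt_mul μ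
      ((withDensity_absolutelyContinuous _ _).ae_le hnn) hY.aemeasurable hη, hμ,
      lintegral_withDensity_eq_lintegral_mul _ hYp hYη, hI]
    apply lintegral_congr_ae
    filter_upwards [hnn] with a ha
    rw [Pi.mul_apply, ← ENNReal.ofReal_mul (Real.rpow_nonneg ha _)]
    congr 1
    exact Real.rpow_add_of_nonneg ha (by linarith) hη.le
  set J := ∫⁻ t in Set.Ioi (0 : ℝ),
    P {a : Ω | t < ε⁻¹ * Y a} * ENNReal.ofReal (t ^ (p + η - 1)) with hJ
  have hJ1 : ENNReal.ofReal (p + η) * J = ENNReal.ofReal ((ε⁻¹) ^ (p + η)) * I := by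
    rw [hJ, ← lintegral_rpow_eq_lintegral_meas_lt_mul P (f := fun a => ε⁻¹ * Y a)
      (by filter_upwards [hnn] with a ha using mul_nonneg (by positivity) ha)
      (hY.const_mul _).aemeasurable (by linarith), hI,
      ← lintegral_const_mul _ ((hY.pow_const _).ennreal_ofReal)]
    apply lintegral_congr_ae
    filter_upwards [hnn] with a ha
    rw [Real.mul_rpow (by positivity) ha, ENNReal.ofReal_mul (by positivity)]
  have hJ2 : J ≤ ENNReal.ofReal ((ε⁻¹) ^ (p + η)) * I := by
    rw [← hJ1]
    refine le_mul_of_one_le_left (by simp) ?_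
    rw [← ENNReal.ofReal_one]
    exact ENNReal.ofReal_le_ofReal (by linarith)
  have hG : ∫⁻ t in Set.Ioc (0 : ℝ) 1, ENNReal.ofReal (t ^ (η - 1)) = ENNReal.ofReal (1 / η) := by
    rw [← ofReal_integral_eq_lintegral_ofReal]
    · rw [← intervalIntegral.integral_of_le zero_le_one, integral_rpow (Or.inl (by linarith))]
      simp [hη.ne']
    · exact (intervalIntegrable_iff_integrableOn_Ioc_of_le zero_le_one).1
        (intervalIntegral.intervalIntegrable_rpow' (by linarith))
    · filter_upwards [ae_restrict_mem measurableSet_Ioc] with t ht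
      exact Real.rpow_nonneg ht.1.le _
  have hmt : Measurable (fun t : ℝ => ENNReal.ofReal (t ^ (η - 1))) :=
    (measurable_id.pow_const _).ennreal_ofReal
  have hL : ∫⁻ t in Set.Ioi 0, μ {a : Ω | t < Y a} * ENNReal.ofReal (t ^ (η - 1)) ≤
      ENNReal.ofReal C * ENNReal.ofReal (1 / η) + ENNReal.ofReal D * J := by
    calc _ ≤ ∫⁻ t in Set.Ioi (0 : ℝ), ((Set.Ioc 0 1).indicator
            (fun t => ENNReal.ofReal C * ENNReal.ofReal (t ^ (η - 1))) t +
            ENNReal.ofReal D * (P {a : Ω | t < ε⁻¹ * Y a} * ENNReal.ofReal (t ^ (p + η - 1)))) := by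
          apply setLIntegral_mono_ae' measurableSet_Ioi
          refine Eventually.of_forall fun t ht => ?_
          have ht0 : 0 < t := ht
          rw [hset]
          rcases le_or_gt t 1 with h1 | h1
          · rw [Set.indicator_of_mem (show t ∈ Set.Ioc (0 : ℝ) 1 from ⟨ht0, h1⟩)]
            refine le_add_right ?_
            gcongr
            exact (setIntegral_le_integral hint hnnp).trans hC
          · refine le_add_left ?_
            have hs : {a : Ω | t < ε⁻¹ * Y a} = {a | ε * t < Y a} := by
              ext a
              simp only [Set.mem_ofPred_eq]
              rw [lt_inv_mul_iff₀ hε]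
            rw [hs, ← ofReal_measureReal (by simp), ← ENNReal.ofReal_mul measureReal_nonneg,
              ← ENNReal.ofReal_mul hD, ← ENNReal.ofReal_mul' (by positivity)]
            apply ENNReal.ofReal_le_ofReal
            have e : t ^ (p + η - 1) = t ^ p * t ^ (η - 1) := by
              rw [← Real.rpow_add ht0]; congr 1; ring
            calc _ ≤ (D * t ^ p * P.real {a | ε * t < Y a}) * t ^ (η - 1) := by
                  gcongr
                  exact htail t h1.le
              _ = _ := by rw [e]; ring
      _ = _ := by
          rw [lintegral_add_left ((hmt.const_mul _).indicator measurableSet_Ioc)]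
          congr 1
          · rw [setLIntegral_indicator measurableSet_Ioc,
              Set.inter_eq_left.2 Set.Ioc_subset_Ioi_self, lintegral_const_mul _ hmt, hG]
          · rw [lintegral_const_mul' _ _ ENNReal.ofReal_ne_top]
  have hfin : I ≤ ENNReal.ofReal C + ENNReal.ofReal (1 / 2) * I := by
    calc I ≤ ENNReal.ofReal η * (ENNReal.ofReal C * ENNReal.ofReal (1 / η) +
          ENNReal.ofReal D * (ENNReal.ofReal ((ε⁻¹) ^ (p + η)) * I)) := by
          rw [hI1]
          nth_rewrite 2 [← hI1]
          gcongr
          exact hL.trans (by gcongr)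
      _ = ENNReal.ofReal C + ENNReal.ofReal (η * D * (ε⁻¹) ^ (p + η)) * I := by
          have e : η * (C * (1 / η)) = C := by field_simp
          rw [mul_add, ← ENNReal.ofReal_mul hC0, ← ENNReal.ofReal_mul hη.le, e,
            ENNReal.ofReal_mul (by positivity), ENNReal.ofReal_mul hη.le]
          ring
      _ ≤ _ := by gcongr
  rw [← ENNReal.ofReal_toReal hIfin] at hfin ⊢
  rw [← ENNReal.ofReal_mul (by norm_num), ← ENNReal.ofReal_add hC0 (by positivity),
    ENNReal.ofReal_le_ofReal_iff (by positivity)] at hfin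
  exact ENNReal.ofReal_le_ofReal (by linarith)

lemma aux_main (P : Measure Ω) [IsProbabilityMeasure P] (ℱ : Filtration ℕ mΩ) (M : ℕ → Ω → ℝ)
    (hmart : Martingale M ℱ P) (hpos : ∀ n, 0 ≤ᵐ[P] M n)
    (hM0 : ∀ᵐ a ∂P, M 0 a = 1)
    (hlin : LinearStructure P ℱ M)
    (K : ℝ) (hK : 1 < K)
    (hstep : ∀ n : ℕ, ∀ᵐ a ∂P, M (n + 1) a ≤ K * M n a)
    (c : ℝ) (hc0 : 0 ≤ c) (hc1 : c < 1) (hc : ∀ l, ∫ a, max (1 - M l a) 0 ∂P ≤ c)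
    (p : ℝ) (hp : 1 ≤ p) (C : ℝ) (hC : ∀ n, ∫ a, M n a ^ p ∂P ≤ C) (hC0 : 0 ≤ C) :
    ∃ q : ℝ, p < q ∧ (⨆ n : ℕ, ∫⁻ a, ENNReal.ofReal (M n a) ^ q ∂P) < ⊤ := by
  have hmeas : ∀ n, Measurable (M n) := fun n =>
    ((hmart.stronglyMeasurable n).mono (ℱ.le n)).measurable
  have hbd : ∀ l, ∀ᵐ a ∂P, 0 ≤ M l a ∧ M l a ≤ K ^ l := by
    intro l
    filter_upwards [aux_ratio P M K hK hstep 0 l, hM0, hpos l] with a h1 h2 h3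
    rw [zero_add, h2, mul_one] at h1
    exact ⟨h3, h1⟩
  have hε0 : 0 < (1 - c) / 2 := by linarith
  set ε := (1 - c) / 2 with hε
  have hε1 : 1 ≤ ε⁻¹ := (one_le_inv₀ hε0).2 (by linarith)
  set D := K ^ p * C * ε⁻¹ with hD
  have hD0 : 0 ≤ D := by positivity
  set E := D * (ε⁻¹) ^ (p + 1) with hE
  have hE0 : 0 ≤ E := by positivity
  set η := min 1 (1 / (2 * (E + 1))) with hη
  have hη0 : 0 < η := by positivity
  have hη1 : η ≤ 1 := min_le_left _ _
  have hηE : η * E ≤ 1 / 2 := by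
    calc η * E ≤ 1 / (2 * (E + 1)) * E := mul_le_mul_of_nonneg_right (min_le_right _ _) hE0
      _ ≤ 1 / 2 := by
        rw [div_mul_eq_mul_div, div_le_div_iff₀ (by positivity) (by norm_num)]
        linarith
  refine ⟨p + η, by linarith, lt_of_le_of_lt (iSup_le fun n => ?_)
    (ENNReal.ofReal_lt_top (r := 2 * C))⟩
  have hst := aux_step P (M n) (hmeas n) (K ^ n) C D ε p η (hbd n) hε0 hp hη0 hD0 hC0 (hC n) ?_ ?_
  · refine le_trans (le_of_eq ?_) hst
    apply lintegral_congr_ae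
    filter_upwards [hpos n] with a ha
    exact ENNReal.ofReal_rpow_of_nonneg ha (by linarith)
  · intro t ht
    refine (aux_tail P ℱ M hmart hpos hM0 hlin K hK hstep c hc0 hc1 hc p hp C hC hC0 t ht n).trans
      (le_of_eq ?_)
    rw [Real.mul_rpow (by linarith) (by linarith), hD]
    ring
  · calc η * D * (ε⁻¹) ^ (p + η) ≤ η * D * (ε⁻¹) ^ (p + 1) := by
          gcongr
      _ = η * E := by rw [hE]; ring
      _ ≤ 1 / 2 := hηE

/-- `L^p` bound for martingales with linear structure: let `(M_n)` be a
nonnegative martingale with `M_0 = 1` satisfying the linear-structure convexity property,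
and suppose there is `K > 1` with `P(M_{n+1} ≤ K M_n) = 1` for every `n`.  If
`P(M_∞ > 0) > 0`, then there exists `p > 1` with `sup_n E[M_n^p] < ∞`.  Moreover the set of
such exponents is open: if `sup_n E[M_n^p] < ∞` for some `p > 1`, then there is `q > p`
with `sup_n E[M_n^q] < ∞`. -/
theorem lp_bound_linear_structure
    (P : Measure Ω) [IsProbabilityMeasure P] (ℱ : Filtration ℕ mΩ) (M : ℕ → Ω → ℝ)
    (hmart : Martingale M ℱ P) (hpos : ∀ n, 0 ≤ᵐ[P] M n)
    (hM0 : ∀ᵐ a ∂P, M 0 a = 1)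
    (hlin : LinearStructure P ℱ M)
    (K : ℝ) (hK : 1 < K)
    (hstep : ∀ n : ℕ, ∀ᵐ a ∂P, M (n + 1) a ≤ K * M n a)
    (Minf : Ω → ℝ)
    (htend : ∀ᵐ a ∂P, Tendsto (fun n => M n a) atTop (𝓝 (Minf a)))
    (hposlim : 0 < P {a | 0 < Minf a}) :
    (∃ p : ℝ, 1 < p ∧ (⨆ n : ℕ, ∫⁻ a, ENNReal.ofReal (M n a) ^ p ∂P) < ⊤) ∧
    (∀ p : ℝ, 1 < p → (⨆ n : ℕ, ∫⁻ a, ENNReal.ofReal (M n a) ^ p ∂P) < ⊤ →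
      ∃ q : ℝ, p < q ∧ (⨆ n : ℕ, ∫⁻ a, ENNReal.ofReal (M n a) ^ q ∂P) < ⊤) := by
  obtain ⟨c, hc0, hc1, hc⟩ := aux_c P ℱ M hmart hpos Minf htend hposlim
  constructor
  · refine aux_main P ℱ M hmart hpos hM0 hlin K hK hstep c hc0 hc1 hc 1 le_rfl 1 ?_ zero_le_one
    intro n
    have h := hmart.setIntegral_eq (Nat.zero_le n) MeasurableSet.univ
    simp only [setIntegral_univ] at h
    simp only [Real.rpow_one]
    rw [← h, integral_congr_ae hM0]
    simp
  · intro p hp hsup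
    refine aux_main P ℱ M hmart hpos hM0 hlin K hK hstep c hc0 hc1 hc p hp.le
      (⨆ n : ℕ, ∫⁻ a, ENNReal.ofReal (M n a) ^ p ∂P).toReal ?_ ENNReal.toReal_nonneg
    intro n
    rw [integral_eq_lintegral_of_nonneg_ae
      (by filter_upwards [hpos n] with a ha using Real.rpow_nonneg ha _)
      ((((hmart.stronglyMeasurable n).mono (ℱ.le n)).measurable.pow_const p).aestronglyMeasurable)]
    apply ENNReal.toReal_mono hsup.ne
    refine le_trans (le_of_eq ?_)
      (le_iSup (fun n : ℕ => ∫⁻ a, ENNReal.ofReal (M n a) ^ p ∂P) n)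
    apply lintegral_congr_ae
    filter_upwards [hpos n] with a ha
    exact (ENNReal.ofReal_rpow_of_nonneg ha (by linarith)).symm

end
end

section
/- Tail lower bound for vanishing martingales with linear structure: let (M_n)_{n≥0} be a nonnegative martingale with M_0 = 1 satisfying the linear-structure convexity property, and suppose there exists K > 1 such that P(M_{n+1} ≤ K·M_n) = 1 for every n ∈ ℕ. If M_∞ = 0 almost surely, then for every t > 1, P(M_∞* > t) > 1/(4K²t). -/
open MeasureTheory ProbabilityTheory Filter Topology
open scoped ENNReal NNReal

noncomputable section

variable {Ω : Type*} {mΩ : MeasurableSpace Ω}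

/-- Tail lower bound for vanishing martingales with linear structure: let
`(M_n)` be a nonnegative martingale with `M_0 = 1` satisfying the linear-structure convexity
property, and suppose there is `K > 1` with `P(M_{n+1} ≤ K M_n) = 1` for every `n`.  If
`M_∞ = 0` almost surely, then for every `t > 1`,
`P(M_∞* > t) > 1/(4K²t)`, where `M_∞* = sup_n M_n` (computed in `[0,∞]`). -/
theorem tail_lower_bound_linear_structure
    (P : Measure Ω) [IsProbabilityMeasure P] (ℱ : Filtration ℕ mΩ) (M : ℕ → Ω → ℝ)
    (hmart : Martingale M ℱ P) (hpos : ∀ n, 0 ≤ᵐ[P] M n)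
    (hM0 : ∀ᵐ a ∂P, M 0 a = 1)
    (hlin : LinearStructure P ℱ M)
    (K : ℝ) (hK : 1 < K)
    (hstep : ∀ n : ℕ, ∀ᵐ a ∂P, M (n + 1) a ≤ K * M n a)
    (Minf : Ω → ℝ)
    (htend : ∀ᵐ a ∂P, Tendsto (fun n => M n a) atTop (𝓝 (Minf a)))
    (hzero : ∀ᵐ a ∂P, Minf a = 0) :
    ∀ t : ℝ, 1 < t →
      ENNReal.ofReal (1 / (4 * K ^ 2 * t)) <
        P {a | ENNReal.ofReal t < ⨆ n : ℕ, ENNReal.ofReal (M n a)} := by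
  intro t ht
  let A : ℕ → Set Ω := fun n => {a | ∀ i ≤ n, M i a ≤ t}
  set S : Set Ω := {a | ENNReal.ofReal t < ⨆ n : ℕ, ENNReal.ofReal (M n a)} with hS
  have hK0 : 0 < K := by linarith
  have ht0 : 0 < t := by linarith
  have hAm : ∀ n, MeasurableSet[ℱ n] (A n) := by
    intro n
    have : A n = ⋂ i, ⋂ (_ : i ≤ n), {a | M i a ≤ t} := by
      ext a; simp [A]
    rw [this]
    refine MeasurableSet.iInter fun i => MeasurableSet.iInter fun hi => ?_
    have h1 : Measurable[ℱ i] (M i) := (hmart.1 i).measurable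
    exact ℱ.mono hi _ (h1 measurableSet_Iic)
  have hAm' : ∀ n, MeasurableSet (A n) := fun n => ℱ.le n _ (hAm n)
  have hint : ∀ n, Integrable (M n) P := hmart.integrable
  have hsub : ∀ n, A (n+1) ⊆ A n := fun n a ha i hi => ha i (by omega)
  have key : ∀ n, 1 ≤ K * t * P.real (A n)ᶜ + ∫ a in A n, M n a ∂P := by
    intro n
    induction n with
    | zero =>
      have hA0 : A 0 =ᵐ[P] (Set.univ : Set Ω) := by
        rw [eventuallyEq_univ]
        filter_upwards [hM0] with a ha i hi
        obtain rfl : i = 0 := by omega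
        linarith
      have h1 : ∫ a in A 0, M 0 a ∂P = 1 := by
        rw [setIntegral_congr_set hA0, setIntegral_univ, integral_congr_ae hM0]
        simp
      rw [h1]
      have : 0 ≤ K * t * P.real (A 0)ᶜ := by positivity
      linarith
    | succ n ih =>
      have h1 : ∫ a in A n, M n a ∂P = ∫ a in A n, M (n+1) a ∂P :=
        hmart.setIntegral_eq (Nat.le_succ n) (hAm n)
      have h2 : ∫ a in A n, M (n+1) a ∂P
          = ∫ a in A (n+1), M (n+1) a ∂P + ∫ a in A n \ A (n+1), M (n+1) a ∂P := by
        rw [← setIntegral_union Set.disjoint_sdiff_right ((hAm' n).diff (hAm' (n+1)))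
          (hint _).integrableOn (hint _).integrableOn, Set.union_sdiff_cancel (hsub n)]
      have h3 : ∫ a in A n \ A (n+1), M (n+1) a ∂P
          ≤ ∫ a in A n \ A (n+1), K * t ∂P := by
        refine setIntegral_mono_on_ae (hint _).integrableOn (integrable_const _).integrableOn
          ((hAm' n).diff (hAm' (n+1))) ?_
        filter_upwards [hstep n] with a ha hm
        have := hm.1 n le_rfl
        nlinarith
      rw [setIntegral_const, smul_eq_mul] at h3
      have h4 : P.real (A (n+1))ᶜ = P.real (A n)ᶜ + P.real (A n \ A (n+1)) := by
        have hd : Disjoint (A n)ᶜ (A n \ A (n+1)) := Set.disjoint_left.2 fun a h h' => h h'.1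
        rw [← measureReal_union (μ := P) hd
          ((hAm' n).diff (hAm' (n+1)))]
        congr 1
        ext a
        have := @hsub n a
        simp only [Set.mem_compl_iff, Set.mem_union, Set.mem_diff]
        tauto
      rw [h4]
      nlinarith
  have hAS : ∀ n, (A n)ᶜ ⊆ S := by
    intro n a ha
    have : ∃ i, i ≤ n ∧ t < M i a := by
      by_contra hcon
      push Not at hcon
      exact ha hcon
    obtain ⟨i, -, hi⟩ := this
    exact lt_of_lt_of_le ((ENNReal.ofReal_lt_ofReal_iff (ht0.trans hi)).2 hi)
      (le_iSup (fun n => ENNReal.ofReal (M n a)) i)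
  have hlim : Tendsto (fun n => ∫ a in A n, M n a ∂P) atTop (𝓝 0) := by
    have hall : ∀ᵐ a ∂P, ∀ n, 0 ≤ M n a := ae_all_iff.2 hpos
    have h := tendsto_integral_of_dominated_convergence (μ := P)
      (F := fun n => (A n).indicator (M n)) (f := fun _ => (0 : ℝ)) (fun _ => t)
      (fun n => ((hint n).indicator (hAm' n)).aestronglyMeasurable) (integrable_const _)
      (fun n => by
        filter_upwards [hall] with a ha
        by_cases hm : a ∈ A n
        · rw [Set.indicator_of_mem hm, Real.norm_of_nonneg (ha n)]
          exact hm n le_rfl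
        · rw [Set.indicator_of_notMem hm]; simpa using ht0.le)
      (by
        filter_upwards [hall, htend, hzero] with a ha h1 h2
        rw [h2] at h1
        refine squeeze_zero (fun n => Set.indicator_apply_nonneg fun _ => ha n) (fun n => ?_) h1
        exact Set.indicator_apply_le' (fun _ => le_rfl) (fun _ => ha n))
    simpa [integral_indicator (hAm' _)] using h
  have hfin : 1 ≤ K * t * P.real S := by
    have h5 : Tendsto (fun n => K * t * P.real S + ∫ a in A n, M n a ∂P) atTop
        (𝓝 (K * t * P.real S + 0)) := hlim.const_add _
    rw [add_zero] at h5
    refine ge_of_tendsto' h5 fun n => (key n).trans ?_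
    have := measureReal_mono (μ := P) (hAS n)
    gcongr
  rw [ENNReal.ofReal_lt_iff_lt_toReal (by positivity) (measure_ne_top _ _)]
  change _ < P.real S
  rw [div_lt_iff₀ (by positivity)]
  have : 0 < P.real S := by
    by_contra hcon
    have : K * t * P.real S ≤ 0 := mul_nonpos_of_nonneg_of_nonpos (by positivity) (not_lt.1 hcon)
    linarith
  nlinarith [mul_pos (mul_pos hK0 ht0) this]

end
end

section
/- Negative moments for martingales with linear structure: let (M_n)_{n≥0} be a nonnegative martingale with M_0 = 1 satisfying the linear-structure convexity property, and suppose there exists K > 1 such that P(M_{n+1} ≥ M_n/K) = 1 for every n ∈ ℕ. If M_∞ > 0 almost surely, then there exists p > 0 such that sup_{n≥0} E[M_n^{−p}] < ∞; furthermore the set of exponents p > 0 with sup_{n≥0} E[M_n^{−p}] < ∞ is open. -/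
open MeasureTheory ProbabilityTheory Filter Topology
open scoped ENNReal NNReal

noncomputable section

variable {Ω : Type*} {mΩ : MeasurableSpace Ω}

/-- Tangent line inequality for negative powers. -/
lemma rpow_neg_tangent {x y r : ℝ} (hx : 0 < x) (hy : 0 < y) (hr : 0 < r) :
    x ^ (-r) - r * x ^ (-r - 1) * (y - x) ≤ y ^ (-r) := by
  have hu : 0 < y / x := div_pos hy hx
  have h1 : 1 - r * (y / x - 1) ≤ (y / x) ^ (-r) := by
    rw [Real.rpow_def_of_pos hu]
    have h2 := Real.add_one_le_exp (Real.log (y / x) * -r)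
    have h3 := Real.log_le_sub_one_of_pos hu
    nlinarith
  have hxr : 0 < x ^ (-r) := Real.rpow_pos_of_pos hx _
  have h4 : y ^ (-r) = x ^ (-r) * (y / x) ^ (-r) := by
    rw [← Real.mul_rpow hx.le hu.le]
    congr 1
    field_simp
  have h5 : x ^ (-r - 1) = x ^ (-r) / x := by
    rw [Real.rpow_sub hx, Real.rpow_one]
  rw [h4, h5]
  have h6 := mul_le_mul_of_nonneg_left h1 hxr.le
  refine le_trans (le_of_eq ?_) h6
  field_simp

lemma convexOn_shift_rpow_neg {r e : ℝ} (hr : 0 < r) (he : 0 < e) :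
    ConvexOn ℝ (Set.Ici 0) (fun x : ℝ => (x + e) ^ (-r)) := by
  refine ⟨convex_Ici 0, ?_⟩
  intro x hx y hy a b ha hb hab
  simp only [Set.mem_Ici] at hx hy
  simp only [smul_eq_mul]
  have hz : 0 < a * x + b * y + e := by positivity
  have h1 := rpow_neg_tangent hz (by linarith : 0 < x + e) hr
  have h2 := rpow_neg_tangent hz (by linarith : 0 < y + e) hr
  set z := a * x + b * y + e with hzdef
  set g := r * z ^ (-r - 1)
  have h3 := mul_le_mul_of_nonneg_left h1 ha
  have h4 := mul_le_mul_of_nonneg_left h2 hb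
  have h5 : a * (x + e - z) + b * (y + e - z) = 0 := by
    rw [hzdef]
    linear_combination (e - (a * x + b * y + e)) * hab
  have hbe : b = 1 - a := by linarith
  have h6 : a * (z ^ (-r) - g * (x + e - z)) + b * (z ^ (-r) - g * (y + e - z)) = z ^ (-r) := by
    linear_combination z ^ (-r) * hab - g * h5
  linarith

/-- all the martingale lies above the deterministic lower barrier -/
lemma lower_barrier {P : Measure Ω} {M : ℕ → Ω → ℝ} {K : ℝ} (hK : 1 < K)
    (hM0 : ∀ᵐ a ∂P, M 0 a = 1)
    (hstep : ∀ n : ℕ, ∀ᵐ a ∂P, M n a / K ≤ M (n + 1) a) :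
    ∀ᵐ a ∂P, ∀ k l, M k a * (K ^ l)⁻¹ ≤ M (k + l) a ∧ 0 < M k a ∧ (K ^ k)⁻¹ ≤ M k a := by
  filter_upwards [hM0, ae_all_iff.2 hstep] with a h0 hs
  have hK0 : 0 < K := by linarith
  have key : ∀ k l, M k a * (K ^ l)⁻¹ ≤ M (k + l) a := by
    intro k l
    induction l with
    | zero => simp
    | succ l ih =>
      have h := hs (k + l)
      refine le_trans ?_ h
      rw [le_div_iff₀ hK0]
      refine le_trans (le_of_eq ?_) ih
      field_simp
      ring
  intro k l
  have h2 := key 0 k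
  rw [h0, zero_add, one_mul] at h2
  have : 0 < (K ^ k)⁻¹ := by positivity
  exact ⟨key k l, by linarith, h2⟩

lemma integrable_neg_pow {P : Measure Ω} [IsProbabilityMeasure P] {X : Ω → ℝ}
    (hX : AEStronglyMeasurable X P) {c r : ℝ} (hc : 0 < c) (hr : 0 < r)
    (h : ∀ᵐ a ∂P, c ≤ X a) : Integrable (fun a => X a ^ (-r)) P := by
  refine Integrable.of_bound (C := c ^ (-r)) ?_ ?_
  · exact (hX.aemeasurable.pow_const _).aestronglyMeasurable
  · filter_upwards [h] with a ha
    rw [Real.norm_of_nonneg (Real.rpow_nonneg (by linarith) _)]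
    exact Real.rpow_le_rpow_of_nonpos hc ha (by linarith)

lemma linear_step {P : Measure Ω} [IsProbabilityMeasure P] {ℱ : Filtration ℕ mΩ} {M : ℕ → Ω → ℝ}
    (hmart : Martingale M ℱ P) (hlin : LinearStructure P ℱ M) {K : ℝ} (hK : 1 < K)
    (hb : ∀ᵐ a ∂P, ∀ k l, M k a * (K ^ l)⁻¹ ≤ M (k + l) a ∧ 0 < M k a ∧ (K ^ k)⁻¹ ≤ M k a)
    {q : ℝ} (hq : 0 < q) (k l : ℕ) {A : Set Ω} (hA : MeasurableSet[ℱ k] A) {c : ℝ} (hc : 0 < c)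
    (hAc : ∀ᵐ a ∂P, a ∈ A → c ≤ M k a) :
    ∫ a in A, M (k + l) a ^ (-q) ∂P ≤ c ^ (-q) * P.real A * ∫ a, M l a ^ (-q) ∂P := by
  have hK0 : 0 < K := by linarith
  have hmeas : ∀ n, StronglyMeasurable (M n) := fun n => (hmart.1 n).mono (ℱ.le n)
  have hintM : ∀ n, Integrable (fun a => M n a ^ (-q)) P := fun n =>
    integrable_neg_pow (hmeas n).aestronglyMeasurable (c := (K ^ n)⁻¹) (by positivity) hq
      (hb.mono fun a ha => (ha n 0).2.2)
  have hA' : MeasurableSet A := ℱ.le k _ hA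
  have main : ∀ e : ℝ, 0 < e → ∫ a in A, M (k + l) a ^ (-q) ∂P ≤
      (1 + e * K ^ l) ^ q * (c ^ (-q) * P.real A * ∫ a, M l a ^ (-q) ∂P) := by
    intro e he
    set f : ℝ → ℝ := fun x => (x + e) ^ (-q) with hf
    have hshift : ∀ X : Ω → ℝ, StronglyMeasurable X → (∀ᵐ a ∂P, 0 ≤ X a) →
        Integrable (fun a => f (X a)) P := by
      intro X hX h0
      refine integrable_neg_pow (X := fun a => X a + e) ?_ he hq ?_
      · exact (hX.measurable.add_const e).stronglyMeasurable.aestronglyMeasurable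
      · filter_upwards [h0] with a ha
        linarith
    have hi1 : Integrable (fun a => f (M (k + l) a / M k a)) P := by
      refine hshift (fun a => M (k + l) a / M k a) ?_ ?_
      · exact ((hmeas _).measurable.div (hmeas _).measurable).stronglyMeasurable
      · filter_upwards [hb] with a ha
        exact div_nonneg (ha (k + l) 0).2.1.le (ha k 0).2.1.le
    have hi2 : Integrable (fun a => f (M l a)) P :=
      hshift _ (hmeas l) (hb.mono fun a ha => (ha l 0).2.1.le)
    have hcond := hlin k l f (convexOn_shift_rpow_neg hq he) hi1 hi2
    have h1 : ∫ a in A, f (M (k + l) a / M k a) ∂P ≤ P.real A * ∫ a, f (M l a) ∂P := by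
      rw [← setIntegral_condExp (ℱ.le k) hi1 hA]
      calc _ ≤ ∫ a in A, (∫ a, f (M l a) ∂P) ∂P := by
            refine integral_mono_ae integrable_condExp.integrableOn (integrable_const _) ?_
            refine ae_restrict_of_ae ?_
            filter_upwards [hcond, hb] with a h1 h2
            exact h1 (h2 k 0).2.1
        _ = _ := by simp
    have h2 : ∫ a, f (M l a) ∂P ≤ ∫ a, M l a ^ (-q) ∂P := by
      refine integral_mono_ae hi2 (hintM l) ?_
      filter_upwards [hb] with a ha
      exact Real.rpow_le_rpow_of_nonpos (ha l 0).2.1 (by linarith) (by linarith)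
    have h3 : ∫ a in A, M (k + l) a ^ (-q) ∂P ≤
        ∫ a in A, ((1 + e * K ^ l) ^ q * c ^ (-q)) * f (M (k + l) a / M k a) ∂P := by
      refine integral_mono_ae (hintM _).integrableOn (hi1.const_mul _).integrableOn ?_
      refine (ae_restrict_iff' hA').2 ?_
      filter_upwards [hb, hAc] with a ha hac haA
      have hk := (ha k 0).2.1
      have hkl := (ha (k + l) 0).2.1
      have hlow := (ha k l).1
      have hck := hac haA
      have hd : 0 < 1 + e * K ^ l := by positivity
      have hfe : f (M (k + l) a / M k a) = (M (k + l) a / M k a + e) ^ (-q) := rfl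
      have hq1 : (1 + e * K ^ l) ^ q = ((1 + e * K ^ l)⁻¹) ^ (-q) := by
        rw [Real.inv_rpow hd.le, Real.rpow_neg hd.le, inv_inv]
      have hpos1 : 0 < M (k + l) a / M k a + e := by positivity
      show M (k + l) a ^ (-q) ≤ _
      rw [hfe, hq1, ← Real.mul_rpow (by positivity) hc.le,
        ← Real.mul_rpow (by positivity) hpos1.le]
      refine Real.rpow_le_rpow_of_nonpos (by positivity) ?_ (by linarith)
      have h5 : M k a ≤ M (k + l) a * K ^ l := by
        rw [← div_eq_mul_inv, div_le_iff₀ (by positivity)] at hlow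
        exact hlow
      calc (1 + e * K ^ l)⁻¹ * c * (M (k + l) a / M k a + e)
          ≤ (1 + e * K ^ l)⁻¹ * M k a * (M (k + l) a / M k a + e) := by gcongr
        _ = (1 + e * K ^ l)⁻¹ * (M (k + l) a + e * M k a) := by field_simp
        _ ≤ (1 + e * K ^ l)⁻¹ * (M (k + l) a + e * (M (k + l) a * K ^ l)) := by gcongr
        _ = M (k + l) a := by field_simp
    rw [integral_const_mul] at h3
    refine h3.trans ?_
    rw [mul_assoc, mul_assoc (c ^ (-q))]
    have : 0 ≤ P.real A := measureReal_nonneg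
    gcongr
    exact h1.trans (by gcongr)
  have hlim : Tendsto (fun e : ℝ => (1 + e * K ^ l) ^ q *
      (c ^ (-q) * P.real A * ∫ a, M l a ^ (-q) ∂P)) (𝓝[>] 0)
      (𝓝 ((1 + 0 * K ^ l) ^ q * (c ^ (-q) * P.real A * ∫ a, M l a ^ (-q) ∂P))) := by
    refine Tendsto.mul_const _ ?_
    refine Tendsto.mono_left ?_ nhdsWithin_le_nhds
    have : ContinuousAt (fun e : ℝ => (1 + e * K ^ l) ^ q) 0 := by
      refine ContinuousAt.rpow_const (by fun_prop) (Or.inl (by norm_num))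
    exact this
  have := ge_of_tendsto hlim (eventually_nhdsWithin_of_forall fun e he => main e he)
  simpa using this

lemma jensen_step {P : Measure Ω} [IsProbabilityMeasure P] {ℱ : Filtration ℕ mΩ} {M : ℕ → Ω → ℝ}
    (hmart : Martingale M ℱ P) {K : ℝ} (hK : 1 < K)
    (hb : ∀ᵐ a ∂P, ∀ k l, M k a * (K ^ l)⁻¹ ≤ M (k + l) a ∧ 0 < M k a ∧ (K ^ k)⁻¹ ≤ M k a)
    {r : ℝ} (hr : 0 < r) {k n : ℕ} (hkn : k ≤ n) {A : Set Ω} (hA : MeasurableSet[ℱ k] A) :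
    ∫ a in A, M k a ^ (-r) ∂P ≤ ∫ a in A, M n a ^ (-r) ∂P := by
  have hK0 : 0 < K := by linarith
  have hmeas : ∀ n, StronglyMeasurable (M n) := fun n => (hmart.1 n).mono (ℱ.le n)
  have hintM : ∀ n, Integrable (fun a => M n a ^ (-r)) P := fun n =>
    integrable_neg_pow (hmeas n).aestronglyMeasurable (c := (K ^ n)⁻¹) (by positivity) hr
      (hb.mono fun a ha => (ha n 0).2.2)
  have hA' : MeasurableSet A := ℱ.le k _ hA
  set g : Ω → ℝ := fun a => r * M k a ^ (-r - 1) with hg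
  have hgm : StronglyMeasurable[ℱ k] g :=
    (((hmart.1 k).measurable.pow_const _).const_mul r).stronglyMeasurable
  have hgb : ∀ᵐ a ∂P, ‖g a‖ ≤ r * ((K ^ k)⁻¹) ^ (-r - 1) := by
    filter_upwards [hb] with a ha
    have h1 := (ha k 0).2.1
    have h2 := (ha k 0).2.2
    rw [Real.norm_of_nonneg (by positivity)]
    have := Real.rpow_le_rpow_of_nonpos (by positivity) h2 (by linarith : -r - 1 ≤ 0)
    simp only [hg]
    gcongr
  have hgi : ∀ j, Integrable (g * M j) P := fun j =>
    (hmart.integrable j).bdd_mul (hgm.mono (ℱ.le k)).aestronglyMeasurable hgb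
  have heq : ∫ a in A, (g * M n) a ∂P = ∫ a in A, (g * M k) a ∂P := by
    rw [← setIntegral_condExp (ℱ.le k) (hgi n) hA]
    refine integral_congr_ae (ae_restrict_of_ae ?_)
    filter_upwards [condExp_mul_of_stronglyMeasurable_left hgm (hgi n) (hmart.integrable n),
      hmart.2 k n hkn] with a h1 h2
    rw [h1, Pi.mul_apply, h2, Pi.mul_apply]
  have h1 : ∫ a in A, (M k a ^ (-r) - ((g * M n) a - (g * M k) a)) ∂P ≤
      ∫ a in A, M n a ^ (-r) ∂P := by
    refine integral_mono_ae ((hintM k).sub ((hgi n).sub (hgi k))).integrableOn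
      (hintM n).integrableOn (ae_restrict_of_ae ?_)
    filter_upwards [hb] with a ha
    have := rpow_neg_tangent (ha k 0).2.1 (ha n 0).2.1 hr
    simp only [hg, Pi.mul_apply]
    linarith
  have hsub : Integrable (fun a => (g * M n) a - (g * M k) a) P := (hgi n).sub (hgi k)
  rw [integral_sub (hintM k).integrableOn hsub.integrableOn,
    integral_sub (hgi n).integrableOn (hgi k).integrableOn, heq] at h1
  linarith

/-- first passage below `θ` at time `k` -/
def firstPass (M : ℕ → Ω → ℝ) (θ : ℝ) (k : ℕ) : Set Ω :=
  {a | M k a < θ ∧ ∀ j < k, θ ≤ M j a}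

lemma firstPass_meas {ℱ : Filtration ℕ mΩ} {M : ℕ → Ω → ℝ}
    (h : ∀ n, StronglyMeasurable[ℱ n] (M n)) (θ : ℝ) (k : ℕ) :
    MeasurableSet[ℱ k] (firstPass M θ k) := by
  have h1 : firstPass M θ k = {a | M k a < θ} ∩ ⋂ j ∈ Finset.range k, {a | θ ≤ M j a} := by
    ext a
    simp [firstPass]
  rw [h1]
  refine MeasurableSet.inter ?_ ?_
  · exact (h k).measurable measurableSet_Iio
  · refine Finset.measurableSet_biInter _ fun j hj => ?_
    have hjk : j ≤ k := (Finset.mem_range.1 hj).le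
    exact ((h j).mono (ℱ.mono hjk)).measurable measurableSet_Ici

lemma firstPass_disj (M : ℕ → Ω → ℝ) (θ : ℝ) :
    Pairwise (Function.onFun Disjoint (firstPass M θ)) := by
  intro i j hij
  rw [Function.onFun, Set.disjoint_left]
  rintro a ⟨h1, h2⟩ ⟨h3, h4⟩
  rcases lt_or_gt_of_ne hij with h | h
  · exact absurd (h4 i h) (not_le.2 h1)
  · exact absurd (h2 j h) (not_le.2 h3)

lemma firstPass_union (M : ℕ → Ω → ℝ) (θ : ℝ) (n : ℕ) :
    (⋃ k ∈ Finset.range (n + 1), firstPass M θ k) = {a | ∃ k ≤ n, M k a < θ} := by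
  classical
  ext a
  simp only [Set.mem_iUnion, Finset.mem_range, Set.mem_ofPred_eq, firstPass, exists_prop]
  constructor
  · rintro ⟨k, hk, h, -⟩
    exact ⟨k, by omega, h⟩
  · rintro ⟨k, hk, h⟩
    have hex : ∃ k, M k a < θ := ⟨k, h⟩
    refine ⟨Nat.find hex, ?_, Nat.find_spec hex, fun j hj => not_lt.1 (Nat.find_min hex hj)⟩
    have := Nat.find_min' hex h
    omega

/-- the event that `M` passes below `θ` -/
def passes (M : ℕ → Ω → ℝ) (θ : ℝ) : Set Ω := {a | ∃ k, M k a < θ}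

lemma passes_meas {M : ℕ → Ω → ℝ} (h : ∀ n, StronglyMeasurable (M n)) (θ : ℝ) :
    MeasurableSet (passes M θ) := by
  have h1 : passes M θ = ⋃ k, {a | M k a < θ} := by
    ext a
    simp [passes]
  rw [h1]
  exact MeasurableSet.iUnion fun k => (h k).measurable measurableSet_Iio

lemma moment_bound {P : Measure Ω} [IsProbabilityMeasure P] {ℱ : Filtration ℕ mΩ} {M : ℕ → Ω → ℝ}
    (hmart : Martingale M ℱ P) (hM0 : ∀ᵐ a ∂P, M 0 a = 1)
    (hlin : LinearStructure P ℱ M) {K : ℝ} (hK : 1 < K)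
    (hb : ∀ᵐ a ∂P, ∀ k l, M k a * (K ^ l)⁻¹ ≤ M (k + l) a ∧ 0 < M k a ∧ (K ^ k)⁻¹ ≤ M k a)
    {q : ℝ} (hq : 0 < q) {θ : ℝ} (hθ : 0 < θ) (hθ1 : θ ≤ 1)
    (hρ : (θ / K) ^ (-q) * P.real (passes M θ) < 1) :
    ∃ D : ℝ, ∀ n, ∫ a, M n a ^ (-q) ∂P ≤ D := by
  have hK0 : 0 < K := by linarith
  have hmeas : ∀ n, StronglyMeasurable (M n) := fun n => (hmart.1 n).mono (ℱ.le n)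
  have hintM : ∀ n, Integrable (fun a => M n a ^ (-q)) P := fun n =>
    integrable_neg_pow (hmeas n).aestronglyMeasurable (c := (K ^ n)⁻¹) (by positivity) hq
      (hb.mono fun a ha => (ha n 0).2.2)
  set ρ := (θ / K) ^ (-q) * P.real (passes M θ) with hρd
  have hρ0 : 0 ≤ ρ := by positivity
  set D := θ ^ (-q) / (1 - ρ) with hD
  have h1ρ : 0 < 1 - ρ := by linarith
  have hD0 : 0 ≤ D := by positivity
  have hDeq : θ ^ (-q) + ρ * D = D := by
    rw [hD]
    field_simp
    ring
  refine ⟨D, fun n => ?_⟩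
  induction n using Nat.strong_induction_on with
  | _ n ih =>
  have hBm : ∀ k, MeasurableSet (firstPass M θ k) := fun k =>
    ℱ.le k _ (firstPass_meas hmart.1 θ k)
  set V : Set Ω := ⋃ k ∈ Finset.range (n + 1), firstPass M θ k with hV
  have hVm : MeasurableSet V := Finset.measurableSet_biUnion _ fun k _ => hBm k
  have hVU : V ⊆ passes M θ := by
    rw [hV, firstPass_union]
    rintro a ⟨k, -, hk⟩
    exact ⟨k, hk⟩
  have hdisj : ((Finset.range (n + 1) : Finset ℕ) : Set ℕ).PairwiseDisjoint (firstPass M θ) :=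
    fun i _ j _ hij => firstPass_disj M θ hij
  have hPV : P.real V = ∑ k ∈ Finset.range (n + 1), P.real (firstPass M θ k) :=
    measureReal_biUnion_finset hdisj fun k _ => hBm k
  have hcompl : ∫ a in Vᶜ, M n a ^ (-q) ∂P ≤ θ ^ (-q) := by
    calc _ ≤ ∫ a in Vᶜ, θ ^ (-q) ∂P := by
          refine integral_mono_ae (hintM n).integrableOn (integrable_const _) ?_
          refine (ae_restrict_iff' hVm.compl).2 (ae_of_all _ fun a ha => ?_)
          rw [hV, firstPass_union] at ha
          have : θ ≤ M n a := by
            by_contra hcon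
            exact ha ⟨n, le_rfl, not_le.1 hcon⟩
          exact Real.rpow_le_rpow_of_nonpos hθ this (by linarith)
      _ = P.real Vᶜ * θ ^ (-q) := by simp
      _ ≤ 1 * θ ^ (-q) := by
          gcongr
          exact measureReal_le_one
      _ = _ := one_mul _
  have hpart : ∀ k ∈ Finset.range (n + 1), ∫ a in firstPass M θ k, M n a ^ (-q) ∂P ≤
      (θ / K) ^ (-q) * P.real (firstPass M θ k) * D := by
    intro k hk
    have hkn : k ≤ n := Nat.lt_succ_iff.1 (Finset.mem_range.1 hk)
    rcases Nat.eq_zero_or_pos k with h0 | h0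
    · have hnull : P (firstPass M θ k) = 0 := by
        rw [measure_eq_zero_iff_ae_notMem]
        filter_upwards [hM0] with a ha hmem
        have := hmem.1
        rw [h0, ha] at this
        linarith
      rw [setIntegral_measure_zero _ hnull]
      positivity
    · have hstep : ∀ᵐ a ∂P, a ∈ firstPass M θ k → θ / K ≤ M k a := by
        filter_upwards [hb] with a ha hmem
        have h1 := (ha (k - 1) 1).1
        rw [Nat.sub_add_cancel h0, pow_one, ← div_eq_mul_inv] at h1
        refine le_trans ?_ h1
        have := hmem.2 (k - 1) (by omega)
        gcongr
      have h2 := linear_step hmart hlin hK hb hq k (n - k) (firstPass_meas hmart.1 θ k)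
        (by positivity) hstep
      rw [Nat.add_sub_cancel' hkn] at h2
      refine h2.trans ?_
      have := ih (n - k) (by omega)
      gcongr
  calc ∫ a, M n a ^ (-q) ∂P = ∫ a in V, M n a ^ (-q) ∂P + ∫ a in Vᶜ, M n a ^ (-q) ∂P :=
        (integral_add_compl hVm (hintM n)).symm
    _ ≤ (θ / K) ^ (-q) * P.real V * D + θ ^ (-q) := by
        refine add_le_add ?_ hcompl
        rw [hPV, hV, integral_biUnion_finset _ (fun k _ => hBm k)
          (fun i _ j _ hij => firstPass_disj M θ hij) (fun k _ => (hintM n).integrableOn),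
          Finset.mul_sum, Finset.sum_mul]
        exact Finset.sum_le_sum hpart
    _ ≤ ρ * D + θ ^ (-q) := by
        rw [hρd]
        have : P.real V ≤ P.real (passes M θ) := measureReal_mono hVU
        gcongr
    _ = D := by rw [add_comm, hDeq]

lemma passes_tendsto {P : Measure Ω} [IsProbabilityMeasure P] {M : ℕ → Ω → ℝ}
    (hmeas : ∀ n, StronglyMeasurable (M n)) (hpos : ∀ᵐ a ∂P, ∀ n, 0 < M n a)
    {Minf : Ω → ℝ} (htend : ∀ᵐ a ∂P, Tendsto (fun n => M n a) atTop (𝓝 (Minf a)))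
    (hposlim : ∀ᵐ a ∂P, 0 < Minf a) :
    Tendsto (P ∘ fun m : ℕ => passes M (1 / ((m : ℝ) + 1))) atTop (𝓝 0) := by
  have hanti : Antitone fun m : ℕ => passes M (1 / ((m : ℝ) + 1)) := by
    rintro i j hij a ⟨k, hk⟩
    exact ⟨k, hk.trans_le (Nat.one_div_le_one_div hij)⟩
  have h := tendsto_measure_iInter_atTop (μ := P)
    (fun m : ℕ => (passes_meas hmeas (1 / ((m : ℝ) + 1))).nullMeasurableSet) hanti
    ⟨0, measure_ne_top _ _⟩
  convert h
  symm
  rw [measure_eq_zero_iff_ae_notMem]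
  filter_upwards [hpos, htend, hposlim] with a hp ht hl hmem
  rw [Set.mem_iInter] at hmem
  -- a positive lower bound
  obtain ⟨N, hN⟩ := eventually_atTop.1 (ht.eventually (lt_mem_nhds (half_lt_self hl)))
  have hfin : ∃ c > 0, ∀ k < N, c ≤ M k a := by
    clear hN
    induction N with
    | zero => exact ⟨1, one_pos, by simp⟩
    | succ N ih =>
      obtain ⟨c, hc, hcN⟩ := ih
      refine ⟨min c (M N a), lt_min hc (hp N), fun k hk => ?_⟩
      rcases Nat.lt_succ_iff_lt_or_eq.1 hk with h | h
      · exact (min_le_left _ _).trans (hcN k h)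
      · rw [h]
        exact min_le_right _ _
  obtain ⟨c, hc, hcN⟩ := hfin
  obtain ⟨m, hm⟩ := exists_nat_one_div_lt (lt_min hc (half_pos hl))
  obtain ⟨k, hk⟩ := hmem m
  rcases lt_or_ge k N with h | h
  · have := hcN k h
    have := min_le_left c (Minf a / 2)
    linarith
  · have := hN k h
    have := min_le_right c (Minf a / 2)
    linarith

lemma weak_max {P : Measure Ω} [IsProbabilityMeasure P] {ℱ : Filtration ℕ mΩ} {M : ℕ → Ω → ℝ}
    (hmart : Martingale M ℱ P) {K : ℝ} (hK : 1 < K)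
    (hb : ∀ᵐ a ∂P, ∀ k l, M k a * (K ^ l)⁻¹ ≤ M (k + l) a ∧ 0 < M k a ∧ (K ^ k)⁻¹ ≤ M k a)
    {r : ℝ} (hr : 0 < r) {θ : ℝ} (n : ℕ) :
    θ ^ (-r) * P.real {a | ∃ k ≤ n, M k a < θ} ≤ ∫ a in passes M θ, M n a ^ (-r) ∂P := by
  have hK0 : 0 < K := by linarith
  have hmeas : ∀ n, StronglyMeasurable (M n) := fun n => (hmart.1 n).mono (ℱ.le n)
  have hintM : ∀ n, Integrable (fun a => M n a ^ (-r)) P := fun n =>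
    integrable_neg_pow (hmeas n).aestronglyMeasurable (c := (K ^ n)⁻¹) (by positivity) hr
      (hb.mono fun a ha => (ha n 0).2.2)
  have hBm : ∀ k, MeasurableSet (firstPass M θ k) := fun k =>
    ℱ.le k _ (firstPass_meas hmart.1 θ k)
  have hdisj : ((Finset.range (n + 1) : Finset ℕ) : Set ℕ).PairwiseDisjoint (firstPass M θ) :=
    fun i _ j _ hij => firstPass_disj M θ hij
  calc θ ^ (-r) * P.real {a | ∃ k ≤ n, M k a < θ}
      = ∑ k ∈ Finset.range (n + 1), θ ^ (-r) * P.real (firstPass M θ k) := by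
        rw [← firstPass_union, measureReal_biUnion_finset hdisj fun k _ => hBm k, Finset.mul_sum]
    _ ≤ ∑ k ∈ Finset.range (n + 1), ∫ a in firstPass M θ k, M n a ^ (-r) ∂P := by
        refine Finset.sum_le_sum fun k hk => ?_
        have hkn : k ≤ n := Nat.lt_succ_iff.1 (Finset.mem_range.1 hk)
        refine le_trans ?_ (jensen_step hmart hK hb hr hkn (firstPass_meas hmart.1 θ k))
        calc θ ^ (-r) * P.real (firstPass M θ k) = ∫ a in firstPass M θ k, θ ^ (-r) ∂P := by
              simp [mul_comm]
          _ ≤ _ := by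
              refine integral_mono_ae (integrable_const _) (hintM k).integrableOn ?_
              refine (ae_restrict_iff' (hBm k)).2 ?_
              filter_upwards [hb] with a ha hmem
              exact Real.rpow_le_rpow_of_nonpos (ha k 0).2.1 hmem.1.le (by linarith)
    _ = ∫ a in ⋃ k ∈ Finset.range (n + 1), firstPass M θ k, M n a ^ (-r) ∂P := by
        rw [integral_biUnion_finset _ (fun k _ => hBm k)
          (fun i _ j _ hij => firstPass_disj M θ hij) (fun k _ => (hintM n).integrableOn)]
    _ ≤ _ := by
        refine setIntegral_mono_set (hintM n).integrableOn ?_ ?_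
        · refine ae_restrict_of_ae ?_
          filter_upwards [hb] with a ha
          exact Real.rpow_nonneg (ha n 0).2.1.le _
        · refine LE.le.eventuallyLE ?_
          rw [firstPass_union]
          rintro a ⟨k, -, hk⟩
          exact ⟨k, hk⟩

lemma sup_lint_iff {P : Measure Ω} [IsProbabilityMeasure P] {M : ℕ → Ω → ℝ}
    (hmeas : ∀ n, StronglyMeasurable (M n)) {K : ℝ} (hK : 1 < K)
    (hb : ∀ᵐ a ∂P, ∀ k l, M k a * (K ^ l)⁻¹ ≤ M (k + l) a ∧ 0 < M k a ∧ (K ^ k)⁻¹ ≤ M k a)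
    {q : ℝ} (hq : 0 < q) :
    (⨆ n : ℕ, ∫⁻ a, ENNReal.ofReal (M n a) ^ (-q) ∂P) < ⊤ ↔
      ∃ D : ℝ, ∀ n, ∫ a, M n a ^ (-q) ∂P ≤ D := by
  have hK0 : 0 < K := by linarith
  have hintM : ∀ n, Integrable (fun a => M n a ^ (-q)) P := fun n =>
    integrable_neg_pow (hmeas n).aestronglyMeasurable (c := (K ^ n)⁻¹) (by positivity) hq
      (hb.mono fun a ha => (ha n 0).2.2)
  have heq : ∀ n, ∫⁻ a, ENNReal.ofReal (M n a) ^ (-q) ∂P =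
      ENNReal.ofReal (∫ a, M n a ^ (-q) ∂P) := by
    intro n
    rw [ofReal_integral_eq_lintegral_ofReal (hintM n)]
    · refine lintegral_congr_ae ?_
      filter_upwards [hb] with a ha
      exact ENNReal.ofReal_rpow_of_pos (ha n 0).2.1
    · filter_upwards [hb] with a ha
      exact Real.rpow_nonneg (ha n 0).2.1.le _
  simp_rw [heq]
  constructor
  · intro h
    refine ⟨_, fun n => (ENNReal.ofReal_le_iff_le_toReal h.ne).1 (le_iSup
      (fun n : ℕ => ENNReal.ofReal (∫ a, M n a ^ (-q) ∂P)) n)⟩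
  · rintro ⟨D, hD⟩
    exact lt_of_le_of_lt (iSup_le fun n => ENNReal.ofReal_le_ofReal (hD n)) ENNReal.ofReal_lt_top

lemma limit_integrable {P : Measure Ω} [IsProbabilityMeasure P] {M : ℕ → Ω → ℝ}
    (hmeas : ∀ n, StronglyMeasurable (M n)) {K : ℝ} (hK : 1 < K)
    (hb : ∀ᵐ a ∂P, ∀ k l, M k a * (K ^ l)⁻¹ ≤ M (k + l) a ∧ 0 < M k a ∧ (K ^ k)⁻¹ ≤ M k a)
    {Minf : Ω → ℝ} (htend : ∀ᵐ a ∂P, Tendsto (fun n => M n a) atTop (𝓝 (Minf a)))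
    (hposlim : ∀ᵐ a ∂P, 0 < Minf a)
    {q : ℝ} (hq : 0 < q) (h : (⨆ n : ℕ, ∫⁻ a, ENNReal.ofReal (M n a) ^ (-q) ∂P) < ⊤) :
    Integrable (fun a => Minf a ^ (-q)) P := by
  have hMi : AEMeasurable Minf P :=
    aemeasurable_of_tendsto_metrizable_ae atTop (fun n => (hmeas n).measurable.aemeasurable) htend
  refine ⟨(hMi.pow_const _).aestronglyMeasurable, ?_⟩
  rw [hasFiniteIntegral_iff_ofReal (hposlim.mono fun a ha => Real.rpow_nonneg ha.le _)]
  refine lt_of_le_of_lt ?_ h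
  calc ∫⁻ a, ENNReal.ofReal (Minf a ^ (-q)) ∂P
      = ∫⁻ a, liminf (fun n => ENNReal.ofReal (M n a) ^ (-q)) atTop ∂P := by
        refine lintegral_congr_ae ?_
        filter_upwards [htend, hposlim, hb] with a h1 h2 h3
        have : Tendsto (fun n => ENNReal.ofReal (M n a) ^ (-q)) atTop
            (𝓝 (ENNReal.ofReal (Minf a ^ (-q)))) := by
          have h4 : ∀ n, ENNReal.ofReal (M n a) ^ (-q) = ENNReal.ofReal (M n a ^ (-q)) :=
            fun n => ENNReal.ofReal_rpow_of_pos (h3 n 0).2.1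
          simp_rw [h4]
          exact ENNReal.tendsto_ofReal (h1.rpow_const (Or.inl h2.ne'))
        exact this.liminf_eq.symm
    _ ≤ liminf (fun n => ∫⁻ a, ENNReal.ofReal (M n a) ^ (-q) ∂P) atTop :=
        lintegral_liminf_le fun n => ((hmeas n).measurable.ennreal_ofReal).pow_const _
    _ ≤ _ := by
        refine le_trans (liminf_le_limsup) ?_
        exact limsup_le_of_le (h := Eventually.of_forall fun n => le_iSup
          (fun n : ℕ => ∫⁻ a, ENNReal.ofReal (M n a) ^ (-q) ∂P) n)

lemma strong_max {P : Measure Ω} [IsProbabilityMeasure P] {ℱ : Filtration ℕ mΩ} {M : ℕ → Ω → ℝ}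
    (hmart : Martingale M ℱ P) {K : ℝ} (hK : 1 < K)
    (hb : ∀ᵐ a ∂P, ∀ k l, M k a * (K ^ l)⁻¹ ≤ M (k + l) a ∧ 0 < M k a ∧ (K ^ k)⁻¹ ≤ M k a)
    {Minf : Ω → ℝ} (htend : ∀ᵐ a ∂P, Tendsto (fun n => M n a) atTop (𝓝 (Minf a)))
    (hposlim : ∀ᵐ a ∂P, 0 < Minf a)
    {p : ℝ} (hp : 0 < p) {S : ℝ} (hS : ∀ n, ∫ a, M n a ^ (-p) ∂P ≤ S)
    (hint : Integrable (fun a => Minf a ^ (-p)) P) {θ : ℝ} (hθ : 0 < θ) :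
    θ ^ (-p) * P.real (passes M θ) ≤ ∫ a in passes M θ, Minf a ^ (-p) ∂P := by
  have hK0 : 0 < K := by linarith
  have hmeas : ∀ n, StronglyMeasurable (M n) := fun n => (hmart.1 n).mono (ℱ.le n)
  have hintM : ∀ {q : ℝ}, 0 < q → ∀ n, Integrable (fun a => M n a ^ (-q)) P := fun hq n =>
    integrable_neg_pow (hmeas n).aestronglyMeasurable (c := (K ^ n)⁻¹) (by positivity) hq
      (hb.mono fun a ha => (ha n 0).2.2)
  have hMi : AEMeasurable Minf P :=
    aemeasurable_of_tendsto_metrizable_ae atTop (fun n => (hmeas n).measurable.aemeasurable) htend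
  obtain ⟨r, hr, rfl⟩ : ∃ r, 0 < r ∧ p = r + r := ⟨p / 2, by linarith, by ring⟩
  have hsq : ∀ x : ℝ, 0 < x → x ^ (-(r + r)) = x ^ (-r) * x ^ (-r) := by
    intro x hx
    rw [← Real.rpow_add hx]
    congr 1
    ring
  set U := passes M θ with hU
  have hUm : MeasurableSet U := passes_meas hmeas θ
  set t := θ ^ (-r) with ht
  have ht0 : 0 < t := Real.rpow_pos_of_pos hθ _
  set I := ∫ a in U, Minf a ^ (-(r + r)) ∂P with hI
  have hVlim : Tendsto (fun n => P.real {a | ∃ k ≤ n, M k a < θ}) atTop (𝓝 (P.real U)) := by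
    have hmono : Monotone fun n : ℕ => {a | ∃ k ≤ n, M k a < θ} := by
      rintro i j hij a ⟨k, hk, h⟩
      exact ⟨k, hk.trans hij, h⟩
    have h1 := tendsto_measure_iUnion_atTop (μ := P) hmono
    have h2 : (⋃ n : ℕ, {a | ∃ k ≤ n, M k a < θ}) = U := by
      ext a
      simp only [Set.mem_iUnion, Set.mem_ofPred_eq, hU, passes]
      constructor
      · rintro ⟨n, k, -, h⟩
        exact ⟨k, h⟩
      · rintro ⟨k, h⟩
        exact ⟨k, k, le_rfl, h⟩
    rw [h2] at h1
    exact (ENNReal.tendsto_toReal (measure_ne_top P U)).comp h1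
  have hL : ∀ L : ℝ, 0 < L → t * P.real U ≤ t / 2 * P.real U + I / (2 * t) + S / L := by
    intro L hL
    have hminint : ∀ n, Integrable (fun a => min (M n a ^ (-r)) L) P := fun n =>
      (hintM hr n).inf (integrable_const L)
    have hn : ∀ n, t * P.real {a | ∃ k ≤ n, M k a < θ} ≤
        ∫ a in U, min (M n a ^ (-r)) L ∂P + S / L := by
      intro n
      refine (weak_max hmart hK hb hr n).trans ?_
      have hqi : Integrable (fun a => M n a ^ (-(r + r)) / L) P := (hintM hp n).div_const L
      calc ∫ a in U, M n a ^ (-r) ∂P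
          ≤ ∫ a in U, (min (M n a ^ (-r)) L + M n a ^ (-(r + r)) / L) ∂P := by
            refine integral_mono_ae (hintM hr n).integrableOn
              ((hminint n).add hqi).integrableOn (ae_restrict_of_ae ?_)
            filter_upwards [hb] with a ha
            have h0 := (ha n 0).2.1
            have hx : 0 < M n a ^ (-r) := Real.rpow_pos_of_pos h0 _
            simp only [hsq _ h0]
            rcases le_total (M n a ^ (-r)) L with h | h
            · rw [min_eq_left h]
              have : 0 ≤ M n a ^ (-r) * M n a ^ (-r) / L := by positivity
              linarith
            · rw [min_eq_right h]
              have : M n a ^ (-r) ≤ M n a ^ (-r) * M n a ^ (-r) / L := by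
                rw [le_div_iff₀ hL]
                gcongr
              linarith
        _ = ∫ a in U, min (M n a ^ (-r)) L ∂P + ∫ a in U, M n a ^ (-(r + r)) / L ∂P :=
            integral_add (hminint n).integrableOn hqi.integrableOn
        _ ≤ _ := by
            gcongr
            calc ∫ a in U, M n a ^ (-(r + r)) / L ∂P ≤ ∫ a, M n a ^ (-(r + r)) / L ∂P := by
                  refine setIntegral_le_integral hqi ?_
                  filter_upwards [hb] with a ha
                  exact div_nonneg (Real.rpow_nonneg (ha n 0).2.1.le _) hL.le
              _ = (∫ a, M n a ^ (-(r + r)) ∂P) / L := integral_div _ _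
              _ ≤ S / L := by
                  gcongr
                  exact hS n
    have hlim : Tendsto (fun n => ∫ a in U, min (M n a ^ (-r)) L ∂P) atTop
        (𝓝 (∫ a in U, min (Minf a ^ (-r)) L ∂P)) := by
      refine tendsto_integral_of_dominated_convergence (fun _ => L) ?_ (integrable_const _) ?_ ?_
      · exact fun n => (hminint n).integrableOn.aestronglyMeasurable
      · intro n
        refine ae_restrict_of_ae ?_
        filter_upwards [hb] with a ha
        rw [Real.norm_of_nonneg (le_min (Real.rpow_nonneg (ha n 0).2.1.le _) hL.le)]
        exact min_le_right _ _
      · refine ae_restrict_of_ae ?_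
        filter_upwards [htend, hposlim] with a h1 h2
        exact (h1.rpow_const (Or.inl h2.ne')).min tendsto_const_nhds
    have h1 := le_of_tendsto_of_tendsto' (hVlim.const_mul t) (hlim.add_const (S / L)) hn
    refine h1.trans ?_
    gcongr
    have hci : Integrable (fun a => Minf a ^ (-(r + r)) / (2 * t)) P := hint.div_const _
    calc ∫ a in U, min (Minf a ^ (-r)) L ∂P
        ≤ ∫ a in U, (t / 2 + Minf a ^ (-(r + r)) / (2 * t)) ∂P := by
          refine integral_mono_ae ?_ ((integrable_const _).add hci).integrableOn
            (ae_restrict_of_ae ?_)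
          · refine (Integrable.of_bound (C := L) ?_ ?_).integrableOn
            · exact ((hMi.pow_const _).min aemeasurable_const).aestronglyMeasurable
            · filter_upwards [hposlim] with a ha
              rw [Real.norm_of_nonneg (le_min (Real.rpow_nonneg ha.le _) hL.le)]
              exact min_le_right _ _
          · filter_upwards [hposlim] with a ha
            simp only [hsq _ ha]
            refine (min_le_left _ _).trans ?_
            set x := Minf a ^ (-r)
            have : t / 2 + x * x / (2 * t) - x = (x - t) ^ 2 / (2 * t) := by
              field_simp
              ring
            have h2 : 0 ≤ (x - t) ^ 2 / (2 * t) := by positivity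
            linarith
      _ = t / 2 * P.real U + I / (2 * t) := by
          rw [integral_add (integrable_const _) hci.integrableOn, setIntegral_const,
            integral_div (2 * t) (fun a => Minf a ^ (-(r + r))), smul_eq_mul, mul_comm]
  have hfin : t * P.real U ≤ t / 2 * P.real U + I / (2 * t) := by
    have hlim : Tendsto (fun L : ℝ => t / 2 * P.real U + I / (2 * t) + S / L) atTop
        (𝓝 (t / 2 * P.real U + I / (2 * t) + 0)) :=
      (tendsto_const_nhds.div_atTop tendsto_id).const_add _
    have := ge_of_tendsto hlim ((eventually_gt_atTop 0).mono fun L h => hL L h)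
    linarith
  rw [hsq θ hθ]
  have h2 : t / 2 * P.real U ≤ I / (2 * t) := by linarith
  rw [le_div_iff₀ (by positivity)] at h2
  linarith

/-- Negative moments for martingales with linear structure: let `(M_n)` be
a nonnegative martingale with `M_0 = 1` satisfying the linear-structure convexity property,
and suppose there is `K > 1` with `P(M_{n+1} ≥ M_n/K) = 1` for every `n`.  If `M_∞ > 0`
almost surely, then there exists `p > 0` with `sup_n E[M_n^{−p}] < ∞` (negative powers
computed in `[0,∞]`, so `0^{-p} = ∞`); furthermore the set of such exponents is open. -/
theorem negative_moments_linear_structure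
    (P : Measure Ω) [IsProbabilityMeasure P] (ℱ : Filtration ℕ mΩ) (M : ℕ → Ω → ℝ)
    (hmart : Martingale M ℱ P) (hpos : ∀ n, 0 ≤ᵐ[P] M n)
    (hM0 : ∀ᵐ a ∂P, M 0 a = 1)
    (hlin : LinearStructure P ℱ M)
    (K : ℝ) (hK : 1 < K)
    (hstep : ∀ n : ℕ, ∀ᵐ a ∂P, M n a / K ≤ M (n + 1) a)
    (Minf : Ω → ℝ)
    (htend : ∀ᵐ a ∂P, Tendsto (fun n => M n a) atTop (𝓝 (Minf a)))
    (hposlim : ∀ᵐ a ∂P, 0 < Minf a) :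
    (∃ p : ℝ, 0 < p ∧ (⨆ n : ℕ, ∫⁻ a, ENNReal.ofReal (M n a) ^ (-p) ∂P) < ⊤) ∧
    (∀ p : ℝ, 0 < p → (⨆ n : ℕ, ∫⁻ a, ENNReal.ofReal (M n a) ^ (-p) ∂P) < ⊤ →
      ∃ q : ℝ, p < q ∧ (⨆ n : ℕ, ∫⁻ a, ENNReal.ofReal (M n a) ^ (-q) ∂P) < ⊤) := by
  have hK0 : 0 < K := by linarith
  have hmeas : ∀ n, StronglyMeasurable (M n) := fun n => (hmart.1 n).mono (ℱ.le n)
  have hb := lower_barrier hK hM0 hstep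
  have hU := passes_tendsto hmeas (hb.mono fun a ha n => (ha n 0).2.1) htend hposlim
  have hθ : ∀ m : ℕ, 0 < 1 / ((m : ℝ) + 1) := fun m => Nat.one_div_pos_of_nat
  have hθ1 : ∀ m : ℕ, 1 / ((m : ℝ) + 1) ≤ 1 := fun m => by
    rw [div_le_one (by positivity)]
    linarith [(Nat.cast_nonneg m : (0 : ℝ) ≤ m)]
  -- openness of the condition in the exponent
  have hcont : ∀ (m : ℕ) (p : ℝ),
      (1 / ((m : ℝ) + 1) / K) ^ (-p) * P.real (passes M (1 / ((m : ℝ) + 1))) < 1 →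
      ∃ q, p < q ∧
        (1 / ((m : ℝ) + 1) / K) ^ (-q) * P.real (passes M (1 / ((m : ℝ) + 1))) < 1 := by
    intro m p hlt
    have hpos' : 0 < 1 / ((m : ℝ) + 1) / K := div_pos (hθ m) hK0
    have hc : ContinuousAt (fun q : ℝ =>
        (1 / ((m : ℝ) + 1) / K) ^ (-q) * P.real (passes M (1 / ((m : ℝ) + 1)))) p :=
      ((Real.continuousAt_const_rpow hpos'.ne').comp continuousAt_neg).mul_const _
    have hev : ∀ᶠ q in 𝓝[>] p, _ :=
      (hc.eventually (gt_mem_nhds hlt)).filter_mono nhdsWithin_le_nhds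
    obtain ⟨q, h1, h2⟩ := (hev.and self_mem_nhdsWithin).exists
    exact ⟨q, h2, h1⟩
  constructor
  · obtain ⟨m, hm⟩ := (hU.eventually (gt_mem_nhds (zero_lt_one (α := ℝ≥0∞)))).exists
    have hm' : P.real (passes M (1 / ((m : ℝ) + 1))) < 1 := by
      have := ENNReal.toReal_strict_mono ENNReal.one_ne_top hm
      simpa [Measure.real] using this
    obtain ⟨p, hp, hlt⟩ := hcont m 0 (by simpa using hm')
    exact ⟨p, hp, (sup_lint_iff hmeas hK hb hp).2
      (moment_bound hmart hM0 hlin hK hb hp (hθ m) (hθ1 m) hlt)⟩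
  · intro p hp hsup
    have hint := limit_integrable hmeas hK hb htend hposlim hp hsup
    obtain ⟨S, hS⟩ := (sup_lint_iff hmeas hK hb hp).1 hsup
    have hlim := hint.tendsto_setIntegral_nhds_zero hU
    have hKp : 0 < K ^ (-p) := Real.rpow_pos_of_pos hK0 _
    obtain ⟨m, hm⟩ := (hlim.eventually (gt_mem_nhds hKp)).exists
    have h1 := strong_max hmart hK hb htend hposlim hp hS hint (hθ m)
    have hlt : (1 / ((m : ℝ) + 1) / K) ^ (-p) * P.real (passes M (1 / ((m : ℝ) + 1))) < 1 := by
      rw [Real.div_rpow (hθ m).le hK0.le, div_mul_eq_mul_div, div_lt_one hKp]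
      exact h1.trans_lt hm
    obtain ⟨q, hq, hlt'⟩ := hcont m p hlt
    have hq0 : 0 < q := hp.trans hq
    exact ⟨q, hq, (sup_lint_iff hmeas hK hb hq0).2
      (moment_bound hmart hM0 hlin hK hb hq0 (hθ m) (hθ1 m) hlt')⟩

end
end
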